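/- arXiv:1404.4000 — 2 statements merged into one kernel-verified Lean document; each statement's English description precedes it below -/
import Mathlib

section
/- Each of the operators 𝐞_i, 𝐟_i (1≤i≤n) and 𝐝_a (1≤a≤n+1) on V^{⊗d} commutes with each of the operators T_1,…,T_d; that is, the action of the coideal algebra U^j and the action of the Iwahori–Hecke algebra H_{B_d} on the tensor space V^{⊗d} commute. -/
noncomputable section

/-- `v`, the generator of `ℚ(v)`. -/
def v : RatFunc ℚ := RatFunc.X

/-- The tensor space `𝕍^{⊗d}`, realized with its standard basis
`v_r = v_{r_1} ⊗ ⋯ ⊗ v_{r_d}`, `r ∈ {1,…,N}^d` (`N = 2n+1`). -/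
abbrev TenSp (n d : ℕ) := (Fin d → Fin (2*n+1)) →₀ RatFunc ℚ

/-- The operator `A_1 ⊗ A_2 ⊗ ⋯ ⊗ A_d` on `𝕍^{⊗d}`, where `A_k` is the single-site
operator on `𝕍` with matrix `M k` in the standard basis. -/
def tensorOp (n d : ℕ) (M : Fin d → Matrix (Fin (2*n+1)) (Fin (2*n+1)) (RatFunc ℚ)) :
    Module.End (RatFunc ℚ) (TenSp n d) :=
  (Finsupp.lift (TenSp n d) (RatFunc ℚ) _) fun r =>
    ∑ r' : Fin d → Fin (2*n+1), (∏ k, M k (r' k) (r k)) • Finsupp.single r' 1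

/-- The matrix of the single-site operator `E_i^{(1)}` (`E_i^{(1)} v_{i+1} = v_i`). -/
def matE (n : ℕ) (i : Fin (2*n)) : Matrix (Fin (2*n+1)) (Fin (2*n+1)) (RatFunc ℚ) :=
  fun a b => if (a : ℕ) = (i : ℕ) ∧ (b : ℕ) = (i : ℕ) + 1 then 1 else 0

/-- The matrix of the single-site operator `F_i^{(1)}` (`F_i^{(1)} v_i = v_{i+1}`). -/
def matF (n : ℕ) (i : Fin (2*n)) : Matrix (Fin (2*n+1)) (Fin (2*n+1)) (RatFunc ℚ) :=
  fun a b => if (a : ℕ) = (i : ℕ) + 1 ∧ (b : ℕ) = (i : ℕ) then 1 else 0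

/-- The matrix of the single-site operator `K_a^{(1)}` (`K_a^{(1)} v_b = v^{δ_{ab}} v_b`). -/
def matK (n : ℕ) (a : Fin (2*n+1)) : Matrix (Fin (2*n+1)) (Fin (2*n+1)) (RatFunc ℚ) :=
  fun b c => if b = c then (if b = a then v else 1) else 0

/-- The matrix of `(K_a^{(1)})^{-1}`. -/
def matKinv (n : ℕ) (a : Fin (2*n+1)) : Matrix (Fin (2*n+1)) (Fin (2*n+1)) (RatFunc ℚ) :=
  fun b c => if b = c then (if b = a then v⁻¹ else 1) else 0

/-- `E_i = Σ_p id^{⊗(p−1)} ⊗ E_i^{(1)} ⊗ (K_i^{(1)}(K_{i+1}^{(1)})^{-1})^{⊗(d−p)}`. -/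
def Eop (n d : ℕ) (i : Fin (2*n)) : Module.End (RatFunc ℚ) (TenSp n d) :=
  ∑ p : Fin d, tensorOp n d fun k =>
    if k < p then 1 else if k = p then matE n i else matK n i.castSucc * matKinv n i.succ

/-- `F_i = Σ_p ((K_i^{(1)})^{-1}K_{i+1}^{(1)})^{⊗(p−1)} ⊗ F_i^{(1)} ⊗ id^{⊗(d−p)}`. -/
def Fop (n d : ℕ) (i : Fin (2*n)) : Module.End (RatFunc ℚ) (TenSp n d) :=
  ∑ p : Fin d, tensorOp n d fun k =>
    if k < p then matKinv n i.castSucc * matK n i.succ else if k = p then matF n i else 1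

/-- `K_a = (K_a^{(1)})^{⊗d}`. -/
def Kop (n d : ℕ) (a : Fin (2*n+1)) : Module.End (RatFunc ℚ) (TenSp n d) :=
  tensorOp n d fun _ => matK n a

/-- `K_a^{-1} = ((K_a^{(1)})^{-1})^{⊗d}`. -/
def Kinvop (n d : ℕ) (a : Fin (2*n+1)) : Module.End (RatFunc ℚ) (TenSp n d) :=
  tensorOp n d fun _ => matKinv n a

/-- `𝐞_i := F_i + K_i^{-1}K_{i+1} E_{N−i}` for `1 ≤ i ≤ n`. -/
def eC (n d : ℕ) (i : Fin n) : Module.End (RatFunc ℚ) (TenSp n d) :=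
  Fop n d ⟨(i : ℕ), by have := i.isLt; omega⟩
    + Kinvop n d ⟨(i : ℕ), by have := i.isLt; omega⟩
      * Kop n d ⟨(i : ℕ) + 1, by have := i.isLt; omega⟩
      * Eop n d ⟨2*n - 1 - (i : ℕ), by have := i.isLt; omega⟩

/-- `𝐟_i := E_i K_{N−i}^{-1} K_{N+1−i} + F_{N−i}` for `1 ≤ i ≤ n`. -/
def fC (n d : ℕ) (i : Fin n) : Module.End (RatFunc ℚ) (TenSp n d) :=
  Eop n d ⟨(i : ℕ), by have := i.isLt; omega⟩
      * Kinvop n d ⟨2*n - 1 - (i : ℕ), by have := i.isLt; omega⟩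
      * Kop n d ⟨2*n - (i : ℕ), by have := i.isLt; omega⟩
    + Fop n d ⟨2*n - 1 - (i : ℕ), by have := i.isLt; omega⟩

/-- `𝐝_a` for `1 ≤ a ≤ n+1`: `𝐝_i = K_i^{-1}K_{N+1−i}^{-1}` for `i ≤ n`, and
`𝐝_{n+1} = v·K_{n+1}^{-2}`. -/
def dC (n d : ℕ) (a : Fin (n+1)) : Module.End (RatFunc ℚ) (TenSp n d) :=
  if h : (a : ℕ) < n then
    Kinvop n d ⟨(a : ℕ), by omega⟩ * Kinvop n d ⟨2*n - (a : ℕ), by omega⟩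
  else v • (Kinvop n d ⟨n, by omega⟩ * Kinvop n d ⟨n, by omega⟩)

/-- The value on the basis element `v_r` of the right Hecke operator acting at positions
`a < b` (for `T_j`, `a = j`, `b = j+1`). -/
def bop (n d : ℕ) (a b : Fin d) (r : Fin d → Fin (2*n+1)) : TenSp n d :=
  if r a < r b then Finsupp.single (r ∘ Equiv.swap a b) v
  else if r a = r b then Finsupp.single r (v^2)
  else Finsupp.single r (v^2 - 1) + Finsupp.single (r ∘ Equiv.swap a b) v

/-- The value on the basis element `v_r` of the right Hecke operator `T_d`. -/
def tdop (n d : ℕ) (hd : 0 < d) (r : Fin d → Fin (2*n+1)) : TenSp n d :=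
  let ld : Fin d := ⟨d - 1, by omega⟩
  let r' := Function.update r ld (Fin.rev (r ld))
  if (r ld : ℕ) < n then Finsupp.single r' v
  else if (r ld : ℕ) = n then Finsupp.single r (v^2)
  else Finsupp.single r (v^2 - 1) + Finsupp.single r' v

/-- The family of Hecke operators `T_1, …, T_d` on `𝕍^{⊗d}`. -/
def Tfam (n d : ℕ) (hd : 0 < d) (i : Fin d) : Module.End (RatFunc ℚ) (TenSp n d) :=
  if h : (i : ℕ) + 1 < d then
    (Finsupp.lift (TenSp n d) (RatFunc ℚ) _) (bop n d i ⟨(i : ℕ) + 1, h⟩)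
  else (Finsupp.lift (TenSp n d) (RatFunc ℚ) _) (tdop n d hd)

section LocalIdentities

variable {𝕜 W : Type*} [Field 𝕜] [AddCommGroup W] [Module 𝕜 W]

/-- Two-site form of the commutation of the raising operators with the type `A` Hecke operators. -/
theorem twoSite_raising_comm {N : ℕ} {q : 𝕜} (hq : q ≠ 0) {i j : Fin N} (hij : (j : ℕ) = i + 1)
    (B : Fin N → Fin N → W) (T D : W →ₗ[𝕜] W) (c : 𝕜)
    (hT : ∀ x y, T (B x y) = if x < y then q • B y x else if x = y then q ^ 2 • B x y
      else (q ^ 2 - 1) • B x y + q • B y x)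
    (hD : ∀ x y, D (B x y) =
      (c * ((if x = j then 1 else 0) * (if y = i then q else if y = j then q⁻¹ else 1))) • B i y
        + (c * (if y = j then 1 else 0)) • B x i) (x y : Fin N) :
    D (T (B x y)) = T (D (B x y)) := by
  have hlt : i < j := by omega
  have hside : ∀ z, ¬(z = i ∨ z = j) → z ≠ i ∧ z ≠ j ∧ ((z < i ∧ z < j ∧ ¬ i < z ∧ ¬ j < z) ∨
      (i < z ∧ j < z ∧ ¬ z < i ∧ ¬ z < j)) := by intro z h; omega
  by_cases hx : x = i ∨ x = j <;> by_cases hy : y = i ∨ y = j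
  · rcases hx with rfl | rfl <;> rcases hy with rfl | rfl <;>
      simp [hT, hD, hlt, hlt.not_gt, hlt.ne, hlt.ne'] <;> match_scalars <;> field_simp <;> ring
  · obtain ⟨h1, h2, ⟨h3, h4, h5, h6⟩ | ⟨h3, h4, h5, h6⟩⟩ := hside y hy <;>
      rcases hx with rfl | rfl <;>
      simp [hT, hD, hlt.ne, hlt.ne', h1, h2, h3, h4, h5, h6, h1.symm, h2.symm] <;>
      match_scalars <;> ring
  · obtain ⟨h1, h2, ⟨h3, h4, h5, h6⟩ | ⟨h3, h4, h5, h6⟩⟩ := hside x hx <;>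
      rcases hy with rfl | rfl <;>
      simp [hT, hD, hlt.ne, hlt.ne', h1, h2, h3, h4, h5, h6] <;>
      match_scalars <;> ring
  · rw [not_or] at hx hy
    rw [hT]
    split_ifs <;> simp [hD, hx, hy]

/-- Two-site form of the commutation of the lowering operators with the type `A` Hecke operators. -/
theorem twoSite_lowering_comm {N : ℕ} {q : 𝕜} (hq : q ≠ 0) {i j : Fin N} (hij : (j : ℕ) = i + 1)
    (B : Fin N → Fin N → W) (T D : W →ₗ[𝕜] W) (c : 𝕜)
    (hT : ∀ x y, T (B x y) = if x < y then q • B y x else if x = y then q ^ 2 • B x y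
      else (q ^ 2 - 1) • B x y + q • B y x)
    (hD : ∀ x y, D (B x y) =
      (c * (if x = i then 1 else 0)) • B j y
        + (c * ((if x = i then q⁻¹ else if x = j then q else 1) * (if y = i then 1 else 0))) • B x j)
    (x y : Fin N) :
    D (T (B x y)) = T (D (B x y)) := by
  have hlt : i < j := by omega
  have hside : ∀ z, ¬(z = i ∨ z = j) → z ≠ i ∧ z ≠ j ∧ ((z < i ∧ z < j ∧ ¬ i < z ∧ ¬ j < z) ∨
      (i < z ∧ j < z ∧ ¬ z < i ∧ ¬ z < j)) := by intro z h; omega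
  by_cases hx : x = i ∨ x = j <;> by_cases hy : y = i ∨ y = j
  · rcases hx with rfl | rfl <;> rcases hy with rfl | rfl <;>
      simp [hT, hD, hlt, hlt.not_gt, hlt.ne'] <;> match_scalars <;> field_simp <;> ring
  · obtain ⟨h1, h2, ⟨h3, h4, h5, h6⟩ | ⟨h3, h4, h5, h6⟩⟩ := hside y hy <;>
      rcases hx with rfl | rfl <;>
      simp [hT, hD, hlt.ne', h1, h2, h3, h4, h5, h6, h1.symm, h2.symm] <;>
      match_scalars <;> ring
  · obtain ⟨h1, h2, ⟨h3, h4, h5, h6⟩ | ⟨h3, h4, h5, h6⟩⟩ := hside x hx <;>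
      rcases hy with rfl | rfl <;>
      simp [hT, hD, hlt.ne', h1, h2, h3, h4, h5, h6] <;>
      match_scalars <;> ring
  · rw [not_or] at hx hy
    rw [hT]
    split_ifs <;> simp [hD, hx, hy]

/-- One-site form of the commutation of `𝐞_i` with the type `B` Hecke generator. -/
theorem oneSite_e_comm {n : ℕ} {q : 𝕜} (hq : q ≠ 0) {i i' j j' : Fin (2 * n + 1)}
    (hi : (i : ℕ) < n) (hi' : (i' : ℕ) = i + 1) (hj : (j : ℕ) = 2 * n - 1 - i)
    (hj' : (j' : ℕ) = 2 * n - i)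
    (B : Fin (2 * n + 1) → W) (T D : W →ₗ[𝕜] W) (c : 𝕜)
    (hT : ∀ x, T (B x) = if (x : ℕ) < n then q • B x.rev else if (x : ℕ) = n then q ^ 2 • B x
      else (q ^ 2 - 1) • B x + q • B x.rev)
    (hD : ∀ x, D (B x) = (c * (if x = i then 1 else 0)) • B i'
      + (c * ((if x = j' then 1 else 0) * (if j = i' then q else 1))) • B j) (x : Fin (2 * n + 1)) :
    D (T (B x)) = T (D (B x)) := by
  obtain ⟨hri, hrj, hri', hrj'⟩ : i.rev = j' ∧ j.rev = i' ∧ i'.rev = j ∧ j'.rev = i := by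
    simp only [Fin.ext_iff, Fin.val_rev]; omega
  by_cases hx : x = i ∨ x = i' ∨ x = j ∨ x = j'
  · have h1 : i ≠ j' := by omega
    have h2 : i ≠ i' := by omega
    have h3 : i ≠ j := by omega
    have h4 : j ≠ j' := by omega
    have h5 : i' ≠ j' := by omega
    have hj'n : ¬(j' : ℕ) < n := by omega
    have hj'n' : (j' : ℕ) ≠ n := by omega
    by_cases hij : j = i'
    · subst hij
      have hjn : (j : ℕ) = n := by omega
      rcases hx with rfl | rfl | rfl | rfl <;>
        simp [hT, hD, hi, hjn, hj'n, hj'n', hri, hrj', h1, h4, h1.symm, h2.symm] <;>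
        match_scalars <;> (try field_simp) <;> ring
    · have hi'n : (i' : ℕ) < n := by omega
      have hjn : ¬(j : ℕ) < n := by omega
      have hjn' : (j : ℕ) ≠ n := by omega
      rcases hx with rfl | rfl | rfl | rfl <;>
        simp [hT, hD, hi, hi'n, hjn, hjn', hj'n, hj'n', hri, hrj, hri', hrj', h1, h4, h5, hij,
          h1.symm, h2.symm, h3.symm] <;>
        match_scalars <;> field_simp
  · have hr : x.rev ≠ i ∧ x.rev ≠ i' ∧ x.rev ≠ j ∧ x.rev ≠ j' := by
      simp only [ne_eq, Fin.ext_iff, Fin.val_rev] at hx ⊢; omega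
    simp only [not_or] at hx
    rw [hT]
    split_ifs <;> simp [hD, hx, hr]

/-- One-site form of the commutation of `𝐟_i` with the type `B` Hecke generator. -/
theorem oneSite_f_comm {n : ℕ} {q : 𝕜} (hq : q ≠ 0) {i i' j j' : Fin (2 * n + 1)}
    (hi : (i : ℕ) < n) (hi' : (i' : ℕ) = i + 1) (hj : (j : ℕ) = 2 * n - 1 - i)
    (hj' : (j' : ℕ) = 2 * n - i)
    (B : Fin (2 * n + 1) → W) (T D : W →ₗ[𝕜] W) (c : 𝕜)
    (hT : ∀ x, T (B x) = if (x : ℕ) < n then q • B x.rev else if (x : ℕ) = n then q ^ 2 • B x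
      else (q ^ 2 - 1) • B x + q • B x.rev)
    (hD : ∀ x, D (B x) = (c * ((if x = i' then 1 else 0) * (if i' = j then q⁻¹ else 1))) • B i
      + (c * (if x = j then 1 else 0)) • B j') (x : Fin (2 * n + 1)) :
    D (T (B x)) = T (D (B x)) := by
  obtain ⟨hri, hrj, hri', hrj'⟩ : i.rev = j' ∧ j.rev = i' ∧ i'.rev = j ∧ j'.rev = i := by
    simp only [Fin.ext_iff, Fin.val_rev]; omega
  by_cases hx : x = i ∨ x = i' ∨ x = j ∨ x = j'
  · have h1 : i ≠ j' := by omega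
    have h2 : i ≠ i' := by omega
    have h3 : i ≠ j := by omega
    have h4 : j ≠ j' := by omega
    have h5 : i' ≠ j' := by omega
    have hj'n : ¬(j' : ℕ) < n := by omega
    have hj'n' : (j' : ℕ) ≠ n := by omega
    by_cases hij : j = i'
    · subst hij
      have hjn : (j : ℕ) = n := by omega
      rcases hx with rfl | rfl | rfl | rfl <;>
        simp [hT, hD, hi, hjn, hj'n, hj'n', hri, hrj', h2, h4.symm] <;>
        match_scalars <;> (try field_simp) <;> ring
    · have hi'n : (i' : ℕ) < n := by omega
      have hjn : ¬(j : ℕ) < n := by omega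
      have hjn' : (j : ℕ) ≠ n := by omega
      rcases hx with rfl | rfl | rfl | rfl <;>
        simp [hT, hD, hi, hi'n, hjn, hjn', hj'n, hj'n', hri, hrj, hri', hrj', h2, h3, hij,
          h4.symm, h5.symm, Ne.symm hij] <;>
        match_scalars <;> field_simp
  · have hr : x.rev ≠ i ∧ x.rev ≠ i' ∧ x.rev ≠ j ∧ x.rev ≠ j' := by
      simp only [ne_eq, Fin.ext_iff, Fin.val_rev] at hx ⊢; omega
    simp only [not_or] at hx
    rw [hT]
    split_ifs <;> simp [hD, hx, hr]

end LocalIdentities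

section MonomialOperators

open Finset Function

/-- The tensor product of the single-site operators sending the basis vector `x` at site `k` to
`g k x` times the basis vector `f k x`. -/
def monomialOp (n d : ℕ) (f : Fin d → Fin (2 * n + 1) → Fin (2 * n + 1))
    (g : Fin d → Fin (2 * n + 1) → RatFunc ℚ) : Module.End (RatFunc ℚ) (TenSp n d) :=
  Finsupp.lift (TenSp n d) (RatFunc ℚ) _ fun r =>
    Finsupp.single (fun k => f k (r k)) (∏ k, g k (r k))

variable {n d : ℕ}

theorem end_ext {A B : Module.End (RatFunc ℚ) (TenSp n d)}
    (h : ∀ r, A (Finsupp.single r 1) = B (Finsupp.single r 1)) : A = B :=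
  Finsupp.lhom_ext' fun r => LinearMap.ext_ring (h r)

theorem monomialOp_single (f : Fin d → Fin (2 * n + 1) → Fin (2 * n + 1))
    (g : Fin d → Fin (2 * n + 1) → RatFunc ℚ) (r : Fin d → Fin (2 * n + 1)) :
    monomialOp n d f g (Finsupp.single r 1) =
      (∏ k, g k (r k)) • Finsupp.single (fun k => f k (r k)) 1 := by
  rw [monomialOp, Finsupp.lift_apply, Finsupp.sum_single_index (by rw [zero_smul]), one_smul,
    Finsupp.smul_single_one]

theorem tensorOp_eq_monomialOp
    {M : Fin d → Matrix (Fin (2 * n + 1)) (Fin (2 * n + 1)) (RatFunc ℚ)}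
    {f : Fin d → Fin (2 * n + 1) → Fin (2 * n + 1)}
    {g : Fin d → Fin (2 * n + 1) → RatFunc ℚ}
    (h : ∀ k y x, M k y x = if y = f k x then g k x else 0) :
    tensorOp n d M = monomialOp n d f g := by
  refine end_ext fun r => ?_
  rw [monomialOp_single]
  simp only [tensorOp, h, prod_ite_zero, mem_univ, true_imp_iff, Finsupp.lift_apply,
    Finsupp.sum_single_index, zero_smul, one_smul]
  rw [Finset.sum_eq_single fun k => f k (r k)]
  · simp
  · intro s _ hs
    rw [if_neg fun h' => hs (funext h'), zero_smul]
  · simp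

theorem monomialOp_mul (f f' : Fin d → Fin (2 * n + 1) → Fin (2 * n + 1))
    (g g' : Fin d → Fin (2 * n + 1) → RatFunc ℚ) :
    monomialOp n d f g * monomialOp n d f' g' =
      monomialOp n d (fun k x => f k (f' k x)) (fun k x => g' k x * g k (f' k x)) := by
  refine end_ext fun r => ?_
  rw [Module.End.mul_apply, monomialOp_single, map_smul, monomialOp_single, monomialOp_single,
    smul_smul, prod_mul_distrib]

theorem Kop_eq_monomialOp (a : Fin (2 * n + 1)) :
    Kop n d a = monomialOp n d (fun _ x => x) (fun _ x => if x = a then v else 1) :=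
  tensorOp_eq_monomialOp fun k y x => by
    by_cases h : y = x <;> simp [matK, h]

theorem Kinvop_eq_monomialOp (a : Fin (2 * n + 1)) :
    Kinvop n d a = monomialOp n d (fun _ x => x) (fun _ x => if x = a then v⁻¹ else 1) :=
  tensorOp_eq_monomialOp fun k y x => by
    by_cases h : y = x <;> simp [matKinv, h]

theorem matK_mul_matKinv_apply {a b : Fin (2 * n + 1)} (hab : a ≠ b) (y x : Fin (2 * n + 1)) :
    (matK n a * matKinv n b) y x =
      if y = x then (if x = a then v else if x = b then v⁻¹ else 1) else 0 := by
  rw [Matrix.mul_apply, Finset.sum_eq_single x]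
  · by_cases h : y = x
    · subst h
      by_cases ha : y = a <;> simp [matK, matKinv, ha, hab]
    · simp [matK, matKinv, h]
  · intro z _ hz
    simp [matKinv, hz]
  · simp

theorem matKinv_mul_matK_apply {a b : Fin (2 * n + 1)} (hab : a ≠ b) (y x : Fin (2 * n + 1)) :
    (matKinv n a * matK n b) y x =
      if y = x then (if x = a then v⁻¹ else if x = b then v else 1) else 0 := by
  rw [Matrix.mul_apply, Finset.sum_eq_single x]
  · by_cases h : y = x
    · subst h
      by_cases ha : y = a <;> simp [matK, matKinv, ha, hab]
    · simp [matK, matKinv, h]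
  · intro z _ hz
    simp [matK, hz]
  · simp

/-- The `p`-th summand of the raising operator taking `j` to `i`. -/
def raisingTerm (n d : ℕ) (i j : Fin (2 * n + 1)) (p : Fin d) :
    Module.End (RatFunc ℚ) (TenSp n d) :=
  monomialOp n d (fun k x => if k = p then i else x) fun k x =>
    if k < p then 1 else if k = p then (if x = j then 1 else 0)
      else if x = i then v else if x = j then v⁻¹ else 1

/-- The `p`-th summand of the lowering operator taking `i` to `j`. -/
def loweringTerm (n d : ℕ) (i j : Fin (2 * n + 1)) (p : Fin d) :
    Module.End (RatFunc ℚ) (TenSp n d) :=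
  monomialOp n d (fun k x => if k = p then j else x) fun k x =>
    if k < p then (if x = i then v⁻¹ else if x = j then v else 1)
      else if k = p then (if x = i then 1 else 0) else 1

theorem Eop_eq_sum (i : Fin (2 * n)) :
    Eop n d i = ∑ p, raisingTerm n d i.castSucc i.succ p := by
  refine Finset.sum_congr rfl fun p _ => tensorOp_eq_monomialOp fun k y x => ?_
  rcases lt_trichotomy k p with h | rfl | h
  · simp [h, h.ne, Matrix.one_apply]
  · simp [matE, Fin.ext_iff, ite_and]
  · simp [h.not_gt, h.ne', matK_mul_matKinv_apply (Fin.castSucc_lt_succ (i := i)).ne]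

theorem Fop_eq_sum (i : Fin (2 * n)) :
    Fop n d i = ∑ p, loweringTerm n d i.castSucc i.succ p := by
  refine Finset.sum_congr rfl fun p _ => tensorOp_eq_monomialOp fun k y x => ?_
  rcases lt_trichotomy k p with h | rfl | h
  · simp [h, h.ne, matKinv_mul_matK_apply (Fin.castSucc_lt_succ (i := i)).ne]
  · simp [matF, Fin.ext_iff, ite_and]
  · simp [h.not_gt, h.ne', Matrix.one_apply]

/-- The Hecke operator attached to the sites `a` and `b`. -/
def heckeSwap (n d : ℕ) (a b : Fin d) : Module.End (RatFunc ℚ) (TenSp n d) :=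
  Finsupp.lift (TenSp n d) (RatFunc ℚ) _ (bop n d a b)

/-- The Hecke operator attached to the last site. -/
def heckeLast (n d : ℕ) (hd : 0 < d) : Module.End (RatFunc ℚ) (TenSp n d) :=
  Finsupp.lift (TenSp n d) (RatFunc ℚ) _ (tdop n d hd)

section TwoSites

variable {a b : Fin d}

theorem heckeSwap_update (hab : a ≠ b) (r : Fin d → Fin (2 * n + 1)) (x y : Fin (2 * n + 1)) :
    heckeSwap n d a b (Finsupp.single (update (update r a x) b y) 1) =
      if x < y then v • Finsupp.single (update (update r a y) b x) 1
      else if x = y then v ^ 2 • Finsupp.single (update (update r a x) b y) 1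
      else (v ^ 2 - 1) • Finsupp.single (update (update r a x) b y) 1
        + v • Finsupp.single (update (update r a y) b x) 1 := by
  have hs : update (update r a x) b y ∘ Equiv.swap a b = update (update r a y) b x := by
    funext k
    by_cases ha : k = a
    · subst ha; simp [hab]
    by_cases hb : k = b
    · subst hb; simp [hab]
    simp [Equiv.swap_apply_of_ne_of_ne ha hb, ha, hb]
  rw [heckeSwap, Finsupp.lift_apply, Finsupp.sum_single_index (by rw [zero_smul]), one_smul]
  simp only [bop, hs, update_self, update_of_ne hab, Finsupp.smul_single_one]

theorem monomialOp_update_update (hab : a ≠ b) (f : Fin d → Fin (2 * n + 1) → Fin (2 * n + 1))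
    (g : Fin d → Fin (2 * n + 1) → RatFunc ℚ) (r : Fin d → Fin (2 * n + 1))
    (x y : Fin (2 * n + 1)) :
    monomialOp n d f g (Finsupp.single (update (update r a x) b y) 1) =
      ((∏ k ∈ (univ.erase a).erase b, g k (r k)) * (g a x * g b y)) •
        Finsupp.single (update (update (fun k => f k (r k)) a (f a x)) b (f b y)) 1 := by
  rw [monomialOp_single]
  congr 2
  · rw [← mul_prod_erase univ _ (mem_univ a),
      ← mul_prod_erase (univ.erase a) _ (mem_erase.2 ⟨hab.symm, mem_univ b⟩)]
    have : ∏ k ∈ (univ.erase a).erase b, g k (update (update r a x) b y k) =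
        ∏ k ∈ (univ.erase a).erase b, g k (r k) :=
      prod_congr rfl fun k hk => by
        simp only [mem_erase] at hk
        simp [hk.1, hk.2.1]
    rw [this]
    simp only [update_self, update_of_ne hab]
    ring
  · funext k
    by_cases hb : k = b
    · subst hb; simp
    by_cases ha : k = a
    · subst ha; simp [hb]
    simp [ha, hb]

theorem commute_of_update_update {A B : Module.End (RatFunc ℚ) (TenSp n d)}
    (h : ∀ r x y, A (B (Finsupp.single (update (update r a x) b y) 1)) =
      B (A (Finsupp.single (update (update r a x) b y) 1))) : Commute A B :=
  end_ext fun r => by simpa using h r (r a) (r b)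

theorem commute_monomialOp_heckeSwap (hab : a ≠ b)
    {f : Fin d → Fin (2 * n + 1) → Fin (2 * n + 1)} {g : Fin d → Fin (2 * n + 1) → RatFunc ℚ}
    (hfa : ∀ x, f a x = x) (hfb : ∀ x, f b x = x) (hg : ∀ x, g a x = g b x) :
    Commute (monomialOp n d f g) (heckeSwap n d a b) := by
  refine commute_of_update_update (a := a) (b := b) fun r x y => ?_
  rw [monomialOp_update_update hab, map_smul, heckeSwap_update hab, heckeSwap_update hab]
  simp only [hfa, hfb, hg]
  split_ifs <;>
    simp only [map_add, map_smul, monomialOp_update_update hab, hfa, hfb, hg, smul_add,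
      smul_smul, mul_comm, mul_left_comm]

theorem commute_Kop_heckeSwap (hab : a ≠ b) (c : Fin (2 * n + 1)) :
    Commute (Kop n d c) (heckeSwap n d a b) := by
  rw [Kop_eq_monomialOp]
  exact commute_monomialOp_heckeSwap hab (fun _ => rfl) (fun _ => rfl) fun _ => rfl

theorem commute_Kinvop_heckeSwap (hab : a ≠ b) (c : Fin (2 * n + 1)) :
    Commute (Kinvop n d c) (heckeSwap n d a b) := by
  rw [Kinvop_eq_monomialOp]
  exact commute_monomialOp_heckeSwap hab (fun _ => rfl) (fun _ => rfl) fun _ => rfl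

theorem v_ne_zero : v ≠ 0 := RatFunc.X_ne_zero

theorem commute_sum_of_commute_add {ι R : Type*} [Fintype ι] [DecidableEq ι] [Semiring R]
    {t : ι → R} {T : R} {a b : ι} (hab : a ≠ b) (h : Commute (t a + t b) T)
    (h' : ∀ p, p ≠ a → p ≠ b → Commute (t p) T) : Commute (∑ p, t p) T := by
  rw [← add_sum_erase univ _ (mem_univ a),
    ← add_sum_erase (univ.erase a) _ (mem_erase.2 ⟨hab.symm, mem_univ b⟩), ← add_assoc]
  refine h.add_left (Commute.sum_left _ _ _ fun p hp => ?_)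
  simp only [mem_erase] at hp
  exact h' p hp.2.1 hp.1

theorem update_update_congr {β : Type*} {r s : Fin d → β} (h : ∀ k, k ≠ a → k ≠ b → r k = s k)
    (x y : β) : update (update r a x) b y = update (update s a x) b y := by
  funext k
  by_cases hb : k = b
  · subst hb; simp
  by_cases ha : k = a
  · subst ha; simp [hb]
  simp [ha, hb, h k ha hb]

theorem commute_Eop_heckeSwap (hab : (b : ℕ) = a + 1) (i : Fin (2 * n)) :
    Commute (Eop n d i) (heckeSwap n d a b) := by
  have hlt : a < b := by omega
  rw [Eop_eq_sum]
  refine commute_sum_of_commute_add hlt.ne ?_ fun p ha hb => ?_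
  · refine commute_of_update_update (a := a) (b := b) fun r x y => ?_
    refine twoSite_raising_comm (i := i.castSucc) (j := i.succ) v_ne_zero (by simp)
      (fun x y => (Finsupp.single (update (update r a x) b y) 1 : TenSp n d)) _ _
      (∏ k ∈ (univ.erase a).erase b, if k < a then 1 else
        if r k = i.castSucc then v else if r k = i.succ then v⁻¹ else 1)
      (heckeSwap_update hlt.ne r) (fun x y => ?_) x y
    rw [LinearMap.add_apply, raisingTerm, raisingTerm, monomialOp_update_update hlt.ne,
      monomialOp_update_update hlt.ne]
    congr 2
    · congr 1
      · refine prod_congr rfl fun k hk => ?_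
        simp only [mem_erase] at hk
        simp [hk.2.1]
      · simp [hlt.not_gt, hlt.ne']
    · simp only [if_pos, hlt.ne', if_false]
      rw [update_update_congr fun k hka _ => if_neg hka]
    · congr 1
      · refine prod_congr rfl fun k hk => ?_
        simp only [mem_erase] at hk
        have : k < b ↔ k < a := by omega
        simp [hk.1, this]
      · simp [hlt]
    · simp only [if_pos, hlt.ne, if_false]
      rw [update_update_congr fun k _ hkb => if_neg hkb]
  · have : a < p ↔ b < p := by omega
    exact commute_monomialOp_heckeSwap hlt.ne (fun x => if_neg ha.symm) (fun x => if_neg hb.symm)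
      fun x => by simp [this, ha.symm, hb.symm]

theorem commute_Fop_heckeSwap (hab : (b : ℕ) = a + 1) (i : Fin (2 * n)) :
    Commute (Fop n d i) (heckeSwap n d a b) := by
  have hlt : a < b := by omega
  rw [Fop_eq_sum]
  refine commute_sum_of_commute_add hlt.ne ?_ fun p ha hb => ?_
  · refine commute_of_update_update (a := a) (b := b) fun r x y => ?_
    refine twoSite_lowering_comm (i := i.castSucc) (j := i.succ) v_ne_zero (by simp)
      (fun x y => (Finsupp.single (update (update r a x) b y) 1 : TenSp n d)) _ _
      (∏ k ∈ (univ.erase a).erase b, if k < a then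
        if r k = i.castSucc then v⁻¹ else if r k = i.succ then v else 1 else 1)
      (heckeSwap_update hlt.ne r) (fun x y => ?_) x y
    rw [LinearMap.add_apply, loweringTerm, loweringTerm, monomialOp_update_update hlt.ne,
      monomialOp_update_update hlt.ne]
    congr 2
    · congr 1
      · refine prod_congr rfl fun k hk => ?_
        simp only [mem_erase] at hk
        simp [hk.2.1]
      · simp [hlt.not_gt, hlt.ne']
    · simp only [if_pos, hlt.ne', if_false]
      rw [update_update_congr fun k hka _ => if_neg hka]
    · congr 1
      · refine prod_congr rfl fun k hk => ?_
        simp only [mem_erase] at hk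
        have : k < b ↔ k < a := by omega
        simp [hk.1, this]
      · simp [hlt]
    · simp only [if_pos, hlt.ne, if_false]
      rw [update_update_congr fun k _ hkb => if_neg hkb]
  · have : a < p ↔ b < p := by omega
    exact commute_monomialOp_heckeSwap hlt.ne (fun x => if_neg ha.symm) (fun x => if_neg hb.symm)
      fun x => by simp [this, ha.symm, hb.symm]

end TwoSites

section LastSite

theorem heckeLast_update (hd : 0 < d) (r : Fin d → Fin (2 * n + 1)) (x : Fin (2 * n + 1)) :
    heckeLast n d hd (Finsupp.single (update r ⟨d - 1, by omega⟩ x) 1) =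
      if (x : ℕ) < n then v • Finsupp.single (update r ⟨d - 1, by omega⟩ x.rev) 1
      else if (x : ℕ) = n then v ^ 2 • Finsupp.single (update r ⟨d - 1, by omega⟩ x) 1
      else (v ^ 2 - 1) • Finsupp.single (update r ⟨d - 1, by omega⟩ x) 1
        + v • Finsupp.single (update r ⟨d - 1, by omega⟩ x.rev) 1 := by
  rw [heckeLast, Finsupp.lift_apply, Finsupp.sum_single_index (by rw [zero_smul]), one_smul]
  simp only [tdop, update_self, update_idem, Finsupp.smul_single_one]

theorem monomialOp_update (l : Fin d) (f : Fin d → Fin (2 * n + 1) → Fin (2 * n + 1))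
    (g : Fin d → Fin (2 * n + 1) → RatFunc ℚ) (r : Fin d → Fin (2 * n + 1))
    (x : Fin (2 * n + 1)) :
    monomialOp n d f g (Finsupp.single (update r l x) 1) =
      ((∏ k ∈ univ.erase l, g k (r k)) * g l x) •
        Finsupp.single (update (fun k => f k (r k)) l (f l x)) 1 := by
  rw [monomialOp_single]
  congr 2
  · rw [← prod_erase_mul univ _ (mem_univ l), update_self]
    congr 1
    exact prod_congr rfl fun k hk => by simp [ne_of_mem_erase hk]
  · funext k
    by_cases hl : k = l
    · subst hl; simp
    simp [hl]

theorem commute_of_update {A B : Module.End (RatFunc ℚ) (TenSp n d)} (l : Fin d)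
    (h : ∀ r x, A (B (Finsupp.single (update r l x) 1)) =
      B (A (Finsupp.single (update r l x) 1))) : Commute A B :=
  end_ext fun r => by simpa using h r (r l)

theorem commute_monomialOp_heckeLast (hd : 0 < d)
    {f : Fin d → Fin (2 * n + 1) → Fin (2 * n + 1)} {g : Fin d → Fin (2 * n + 1) → RatFunc ℚ}
    (hf : ∀ x, f ⟨d - 1, by omega⟩ x = x)
    (hg : ∀ x, g ⟨d - 1, by omega⟩ x.rev = g ⟨d - 1, by omega⟩ x) :
    Commute (monomialOp n d f g) (heckeLast n d hd) := by
  refine commute_of_update ⟨d - 1, by omega⟩ fun r x => ?_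
  rw [monomialOp_update, map_smul, hf, heckeLast_update, heckeLast_update]
  split_ifs <;>
    simp only [map_add, map_smul, monomialOp_update, hf, hg, smul_add, smul_smul, mul_comm]

theorem update_congr_of_ne {β : Type*} {l : Fin d} {r s : Fin d → β} (h : ∀ k, k ≠ l → r k = s k)
    (x : β) : update r l x = update s l x := by
  funext k
  by_cases hl : k = l
  · subst hl; simp
  simp [hl, h k hl]

theorem commute_sum_of_commute {ι R : Type*} [Fintype ι] [Semiring R]
    {t : ι → R} {T : R} (l : ι) (h : Commute (t l) T) (h' : ∀ p, p ≠ l → Commute (t p) T) :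
    Commute (∑ p, t p) T :=
  Commute.sum_left _ _ _ fun p _ => by
    by_cases hp : p = l
    · exact hp ▸ h
    · exact h' p hp

theorem commute_Kinvop_mul_Kinvop_heckeLast (hd : 0 < d) {a b : Fin (2 * n + 1)} (hab : b = a.rev) :
    Commute (Kinvop n d a * Kinvop n d b) (heckeLast n d hd) := by
  rw [Kinvop_eq_monomialOp, Kinvop_eq_monomialOp, monomialOp_mul]
  refine commute_monomialOp_heckeLast hd (fun _ => rfl) fun x => ?_
  subst hab
  simp only [Fin.rev_rev, Fin.rev_eq_iff, mul_comm]

theorem commute_eC_heckeLast (hd : 0 < d) (i : Fin n) :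
    Commute (eC n d i) (heckeLast n d hd) := by
  have hi := i.isLt
  obtain ⟨x, hx⟩ : ∃ x : Fin (2 * n + 1), (x : ℕ) = i := ⟨⟨i, by omega⟩, rfl⟩
  obtain ⟨x', hx'⟩ : ∃ x' : Fin (2 * n + 1), (x' : ℕ) = i + 1 := ⟨⟨i + 1, by omega⟩, rfl⟩
  obtain ⟨y, hy⟩ : ∃ y : Fin (2 * n + 1), (y : ℕ) = 2 * n - 1 - i :=
    ⟨⟨2 * n - 1 - i, by omega⟩, rfl⟩
  obtain ⟨y', hy'⟩ : ∃ y' : Fin (2 * n + 1), (y' : ℕ) = 2 * n - i := ⟨⟨2 * n - i, by omega⟩, rfl⟩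
  have he : eC n d i = ∑ p, (loweringTerm n d x x' p
      + Kinvop n d x * Kop n d x' * raisingTerm n d y y' p) := by
    rw [eC, Fop_eq_sum, Eop_eq_sum, Finset.mul_sum, ← Finset.sum_add_distrib,
      show (⟨i, by omega⟩ : Fin (2 * n)).castSucc = x from Fin.ext hx.symm,
      show (⟨i, by omega⟩ : Fin (2 * n)).succ = x' from Fin.ext hx'.symm,
      show (⟨2 * n - 1 - i, by omega⟩ : Fin (2 * n)).castSucc = y from Fin.ext hy.symm,
      show (⟨2 * n - 1 - i, by omega⟩ : Fin (2 * n)).succ = y' from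
        Fin.ext (by simp only [Fin.val_succ]; omega),
      show (⟨i, by omega⟩ : Fin (2 * n + 1)) = x from Fin.ext hx.symm,
      show (⟨i + 1, by omega⟩ : Fin (2 * n + 1)) = x' from Fin.ext hx'.symm]
  have hxy : x ≠ y := by omega
  have hxx' : x ≠ x' := by omega
  obtain ⟨hrx, hry, hrx', hry'⟩ : x.rev = y' ∧ y.rev = x' ∧ x'.rev = y ∧ y'.rev = x := by
    simp only [Fin.ext_iff, Fin.val_rev]; omega
  rw [he]
  refine commute_sum_of_commute ⟨d - 1, by omega⟩ ?_ fun p hp => ?_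
  · refine commute_of_update ⟨d - 1, by omega⟩ fun r z => ?_
    refine oneSite_e_comm (i := x) (i' := x') (j := y) (j' := y') v_ne_zero (by omega) (by omega)
      (by omega) (by omega)
      (fun z => (Finsupp.single (update r ⟨d - 1, by omega⟩ z) 1 : TenSp n d)) _ _
      (∏ k ∈ univ.erase ⟨d - 1, by omega⟩,
        if r k = x then v⁻¹ else if r k = x' then v else 1)
      (heckeLast_update hd r) (fun z => ?_) z
    rw [LinearMap.add_apply, Kinvop_eq_monomialOp, Kop_eq_monomialOp, raisingTerm, loweringTerm,
      monomialOp_mul, monomialOp_mul, monomialOp_update, monomialOp_update]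
    congr 2
    · congr 1
      · refine prod_congr rfl fun k hk => ?_
        have : k < ⟨d - 1, by omega⟩ := by
          have := ne_of_mem_erase hk
          simp only [ne_eq, Fin.ext_iff, Fin.lt_def] at this ⊢
          omega
        simp [this]
      · simp
    · rw [update_congr_of_ne fun k hk => if_neg hk]
      simp
    · congr 1
      · refine prod_congr rfl fun k hk => ?_
        have hkl := ne_of_mem_erase hk
        have : k < ⟨d - 1, by omega⟩ := by
          simp only [ne_eq, Fin.ext_iff, Fin.lt_def] at hkl ⊢
          omega
        by_cases hkx : r k = x <;> simp [this, hkl, hkx, hxx']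
      · simp [hxy.symm]
    · rw [update_congr_of_ne fun k hk => if_neg hk]
      simp
  · have hlt : p < ⟨d - 1, by omega⟩ := by
      simp only [ne_eq, Fin.ext_iff, Fin.lt_def] at hp ⊢
      omega
    refine Commute.add_left ?_ ?_
    · exact commute_monomialOp_heckeLast hd (fun _ => if_neg hlt.ne') fun z => by
        simp [hlt.not_gt, hlt.ne']
    · rw [Kinvop_eq_monomialOp, Kop_eq_monomialOp, raisingTerm, monomialOp_mul, monomialOp_mul]
      refine commute_monomialOp_heckeLast hd (fun _ => if_neg hlt.ne') fun z => ?_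
      simp only [hlt.not_gt, hlt.ne', if_false, Fin.rev_eq_iff, hrx, hry, hrx', hry']
      split_ifs <;> first | (exfalso; omega) | simp

theorem commute_fC_heckeLast (hd : 0 < d) (i : Fin n) :
    Commute (fC n d i) (heckeLast n d hd) := by
  have hi := i.isLt
  obtain ⟨x, hx⟩ : ∃ x : Fin (2 * n + 1), (x : ℕ) = i := ⟨⟨i, by omega⟩, rfl⟩
  obtain ⟨x', hx'⟩ : ∃ x' : Fin (2 * n + 1), (x' : ℕ) = i + 1 := ⟨⟨i + 1, by omega⟩, rfl⟩
  obtain ⟨y, hy⟩ : ∃ y : Fin (2 * n + 1), (y : ℕ) = 2 * n - 1 - i :=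
    ⟨⟨2 * n - 1 - i, by omega⟩, rfl⟩
  obtain ⟨y', hy'⟩ : ∃ y' : Fin (2 * n + 1), (y' : ℕ) = 2 * n - i := ⟨⟨2 * n - i, by omega⟩, rfl⟩
  have hf : fC n d i = ∑ p, (raisingTerm n d x x' p * Kinvop n d y * Kop n d y'
      + loweringTerm n d y y' p) := by
    rw [fC, Fop_eq_sum, Eop_eq_sum, Finset.sum_mul, Finset.sum_mul, ← Finset.sum_add_distrib,
      show (⟨i, by omega⟩ : Fin (2 * n)).castSucc = x from Fin.ext hx.symm,
      show (⟨i, by omega⟩ : Fin (2 * n)).succ = x' from Fin.ext hx'.symm,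
      show (⟨2 * n - 1 - i, by omega⟩ : Fin (2 * n)).castSucc = y from Fin.ext hy.symm,
      show (⟨2 * n - 1 - i, by omega⟩ : Fin (2 * n)).succ = y' from
        Fin.ext (by simp only [Fin.val_succ]; omega),
      show (⟨2 * n - 1 - i, by omega⟩ : Fin (2 * n + 1)) = y from Fin.ext hy.symm,
      show (⟨2 * n - i, by omega⟩ : Fin (2 * n + 1)) = y' from Fin.ext hy'.symm]
  have hyy' : y ≠ y' := by omega
  have hx'y' : x' ≠ y' := by omega
  obtain ⟨hrx, hry, hrx', hry'⟩ : x.rev = y' ∧ y.rev = x' ∧ x'.rev = y ∧ y'.rev = x := by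
    simp only [Fin.ext_iff, Fin.val_rev]; omega
  rw [hf]
  refine commute_sum_of_commute ⟨d - 1, by omega⟩ ?_ fun p hp => ?_
  · refine commute_of_update ⟨d - 1, by omega⟩ fun r z => ?_
    refine oneSite_f_comm (i := x) (i' := x') (j := y) (j' := y') v_ne_zero (by omega) (by omega)
      (by omega) (by omega)
      (fun z => (Finsupp.single (update r ⟨d - 1, by omega⟩ z) 1 : TenSp n d)) _ _
      (∏ k ∈ univ.erase ⟨d - 1, by omega⟩,
        if r k = y then v⁻¹ else if r k = y' then v else 1)
      (heckeLast_update hd r) (fun z => ?_) z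
    rw [LinearMap.add_apply, Kinvop_eq_monomialOp, Kop_eq_monomialOp, raisingTerm, loweringTerm,
      monomialOp_mul, monomialOp_mul, monomialOp_update, monomialOp_update]
    congr 2
    · congr 1
      · refine prod_congr rfl fun k hk => ?_
        have : k < ⟨d - 1, by omega⟩ := by
          have := ne_of_mem_erase hk
          simp only [ne_eq, Fin.ext_iff, Fin.lt_def] at this ⊢
          omega
        by_cases hky : r k = y <;> simp [this, hky, hyy']
      · by_cases hz : z = x' <;> simp [hz, hx'y']
    · rw [update_congr_of_ne fun k hk => if_neg hk]
      simp
    · congr 1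
      · refine prod_congr rfl fun k hk => ?_
        have : k < ⟨d - 1, by omega⟩ := by
          have := ne_of_mem_erase hk
          simp only [ne_eq, Fin.ext_iff, Fin.lt_def] at this ⊢
          omega
        simp [this]
      · simp
    · rw [update_congr_of_ne fun k hk => if_neg hk]
      simp
  · have hlt : p < ⟨d - 1, by omega⟩ := by
      simp only [ne_eq, Fin.ext_iff, Fin.lt_def] at hp ⊢
      omega
    refine Commute.add_left ?_ ?_
    · rw [Kinvop_eq_monomialOp, Kop_eq_monomialOp, raisingTerm, monomialOp_mul, monomialOp_mul]
      refine commute_monomialOp_heckeLast hd (fun _ => if_neg hlt.ne') fun z => ?_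
      simp only [hlt.not_gt, hlt.ne', if_false, Fin.rev_eq_iff, hrx, hry, hrx', hry']
      split_ifs <;> first | (exfalso; omega) | simp
    · exact commute_monomialOp_heckeLast hd (fun _ => if_neg hlt.ne') fun z => by
        simp [hlt.not_gt, hlt.ne']

theorem commute_dC_heckeLast (hd : 0 < d) (a : Fin (n + 1)) :
    Commute (dC n d a) (heckeLast n d hd) := by
  rw [dC]
  split_ifs
  · exact commute_Kinvop_mul_Kinvop_heckeLast hd (Fin.ext (by simp only [Fin.val_rev]; omega))
  · exact (commute_Kinvop_mul_Kinvop_heckeLast hd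
      (Fin.ext (by simp only [Fin.val_rev]; omega))).smul_left v

end LastSite

theorem Tfam_eq (hd : 0 < d) (j : Fin d) :
    (∃ b : Fin d, (b : ℕ) = j + 1 ∧ Tfam n d hd j = heckeSwap n d j b) ∨
      Tfam n d hd j = heckeLast n d hd := by
  by_cases h : (j : ℕ) + 1 < d
  · exact Or.inl ⟨⟨j + 1, h⟩, rfl, by rw [Tfam, dif_pos h]; rfl⟩
  · exact Or.inr (by rw [Tfam, dif_neg h]; rfl)

theorem commute_eC_Tfam (hd : 0 < d) (i : Fin n) (j : Fin d) :
    Commute (eC n d i) (Tfam n d hd j) := by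
  obtain ⟨b, hb, h⟩ | h := Tfam_eq (n := n) hd j <;> rw [h]
  · have hjb : j ≠ b := by omega
    exact (commute_Fop_heckeSwap hb _).add_left (((commute_Kinvop_heckeSwap hjb _).mul_left
      (commute_Kop_heckeSwap hjb _)).mul_left (commute_Eop_heckeSwap hb _))
  · exact commute_eC_heckeLast hd i

theorem commute_fC_Tfam (hd : 0 < d) (i : Fin n) (j : Fin d) :
    Commute (fC n d i) (Tfam n d hd j) := by
  obtain ⟨b, hb, h⟩ | h := Tfam_eq (n := n) hd j <;> rw [h]
  · have hjb : j ≠ b := by omega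
    exact (((commute_Eop_heckeSwap hb _).mul_left (commute_Kinvop_heckeSwap hjb _)).mul_left
      (commute_Kop_heckeSwap hjb _)).add_left (commute_Fop_heckeSwap hb _)
  · exact commute_fC_heckeLast hd i

theorem commute_dC_Tfam (hd : 0 < d) (a : Fin (n + 1)) (j : Fin d) :
    Commute (dC n d a) (Tfam n d hd j) := by
  obtain ⟨b, hb, h⟩ | h := Tfam_eq (n := n) hd j <;> rw [h]
  · have hjb : j ≠ b := by omega
    rw [dC]
    split_ifs
    · exact (commute_Kinvop_heckeSwap hjb _).mul_left (commute_Kinvop_heckeSwap hjb _)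
    · exact ((commute_Kinvop_heckeSwap hjb _).mul_left
        (commute_Kinvop_heckeSwap hjb _)).smul_left v
  · exact commute_dC_heckeLast hd a

end MonomialOperators

/-- Each of the coideal-algebra operators `𝐞_i, 𝐟_i` (`1 ≤ i ≤ n`) and `𝐝_a`
(`1 ≤ a ≤ n+1`) on `𝕍^{⊗d}` commutes with each of the Hecke operators `T_1,…,T_d`:
the actions of `U^ȷ` and `H_{B_d}` on the tensor space commute. -/
theorem stmt12 (n d : ℕ) (hn : 0 < n) (hd : 0 < d) :
    (∀ (i : Fin n) (j : Fin d), eC n d i * Tfam n d hd j = Tfam n d hd j * eC n d i)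
    ∧ (∀ (i : Fin n) (j : Fin d), fC n d i * Tfam n d hd j = Tfam n d hd j * fC n d i)
    ∧ (∀ (a : Fin (n+1)) (j : Fin d), dC n d a * Tfam n d hd j = Tfam n d hd j * dC n d a) := by
  exact ⟨fun i j => commute_eC_Tfam hd i j, fun i j => commute_fC_Tfam hd i j,
    fun a j => commute_dC_Tfam hd a j⟩
end
end

section
/- The assignment sending a pair (V,V') ∈ X_C × X_C to the N×N matrix A=(a_{ij}) with a_{ij} = dim_{F_q}((V_{i−1}+V_i∩V'_j)/(V_{i−1}+V_i∩V'_{j−1})) induces a bijection from the set of Sp(D)-orbits on X_C × X_C (diagonal action) onto Ξ_C, and the assignment sending (V,F) ∈ X_C × Y_C to the N×D matrix B=(b_{ij}) with b_{ij} = dim_{F_q}((V_{i−1}+V_i∩F_j)/(V_{i−1}+V_i∩F_{j−1})) induces a bijection from the set of Sp(D)-orbits on X_C × Y_C onto Π_C. -/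
noncomputable section

open Module

/-- The orthogonal complement of a subspace `W` with respect to a bilinear form `Q`. -/
def orthB {F M : Type} [Field F] [AddCommGroup M] [Module F M]
    (Q : M →ₗ[F] M →ₗ[F] F) (W : Submodule F M) : Submodule F M where
  carrier := {u | ∀ w ∈ W, Q u w = 0}
  add_mem' := by
    intro a b ha hb w hw
    simp [map_add, LinearMap.add_apply, ha w hw, hb w hw]
  zero_mem' := by
    intro w hw
    simp
  smul_mem' := by
    intro c a ha w hw
    simp [map_smul, LinearMap.smul_apply, smul_eq_mul, ha w hw]

/-- `g` belongs to the isometry group of `Q` (for skew-symmetric nondegenerate `Q` on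
`𝔽_q^D` this is the symplectic group `Sp(D)`). -/
def inIsom {F M : Type} [Field F] [AddCommGroup M] [Module F M]
    (Q : M →ₗ[F] M →ₗ[F] F) (g : M ≃ₗ[F] M) : Prop :=
  ∀ u u', Q (g u) (g u') = Q u u'

/-- `V` is a point of `X_C`: an `N`-step flag (`N = 2n`) in `𝔽_q^D` (`D = 2d`) with
`V_i = V_{N−i}^⊥` for all `i`. -/
def IsXCFlag (n d : ℕ) (F : Type) [Field F]
    (Q : (Fin (2*d) → F) →ₗ[F] (Fin (2*d) → F) →ₗ[F] F)
    (V : Fin (2*n+1) → Submodule F (Fin (2*d) → F)) : Prop :=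
  Monotone V ∧ V 0 = ⊥ ∧ V (Fin.last (2*n)) = ⊤ ∧ ∀ i, V i = orthB Q (V i.rev)

/-- `Fl` is a point of `Y_C`: a complete flag in `𝔽_q^D` (`D = 2d`) with
`dim Fl_i = i` and `Fl_i = Fl_{D−i}^⊥` for all `i`. -/
def IsYCFlag (d : ℕ) (F : Type) [Field F]
    (Q : (Fin (2*d) → F) →ₗ[F] (Fin (2*d) → F) →ₗ[F] F)
    (Fl : Fin (2*d+1) → Submodule F (Fin (2*d) → F)) : Prop :=
  Monotone Fl ∧ Fl 0 = ⊥ ∧ Fl (Fin.last (2*d)) = ⊤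
    ∧ (∀ i, finrank F (Fl i) = (i : ℕ)) ∧ ∀ i, Fl i = orthB Q (Fl i.rev)

/-- The `N×N` matrix associated to a pair of `N`-step flags (`N = 2n`). -/
def matXX (n d : ℕ) (F : Type) [Field F]
    (V V' : Fin (2*n+1) → Submodule F (Fin (2*d) → F)) :
    Matrix (Fin (2*n)) (Fin (2*n)) ℕ :=
  fun i j => finrank F ↥(V i.castSucc ⊔ V i.succ ⊓ V' j.succ)
    - finrank F ↥(V i.castSucc ⊔ V i.succ ⊓ V' j.castSucc)

/-- The `N×D` matrix associated to a pair consisting of an `N`-step flag and a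
complete flag (`N = 2n`, `D = 2d`). -/
def matXY (n d : ℕ) (F : Type) [Field F]
    (V : Fin (2*n+1) → Submodule F (Fin (2*d) → F))
    (Fl : Fin (2*d+1) → Submodule F (Fin (2*d) → F)) :
    Matrix (Fin (2*n)) (Fin (2*d)) ℕ :=
  fun i j => finrank F ↥(V i.castSucc ⊔ V i.succ ⊓ Fl j.succ)
    - finrank F ↥(V i.castSucc ⊔ V i.succ ⊓ Fl j.castSucc)

section AdaptedBases

variable {F M : Type} [Field F] [AddCommGroup M] [Module F M]

/-- An `N`-step flag, each of whose members is the orthogonal complement of the member of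
complementary index. -/
structure IsDualFlag (Q : M →ₗ[F] M →ₗ[F] F) {N : ℕ} (V : Fin (N + 1) → Submodule F M) :
    Prop where
  mono : Monotone V
  bot : V 0 = ⊥
  top : V (Fin.last N) = ⊤
  orth : ∀ i, V i = orthB Q (V i.rev)

/-- The matrix of relative dimensions of a pair of flags. -/
def flagMatrix {N N' : ℕ} (V : Fin (N + 1) → Submodule F M)
    (V' : Fin (N' + 1) → Submodule F M) : Matrix (Fin N) (Fin N') ℕ :=
  fun i j => finrank F ↥(V i.castSucc ⊔ V i.succ ⊓ V' j.succ)
    - finrank F ↥(V i.castSucc ⊔ V i.succ ⊓ V' j.castSucc)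

/-- The Gram matrix of a symplectic basis. -/
def hypForm (F : Type) [Field F] {κ : Type} [DecidableEq κ] : κ ⊕ κ → κ ⊕ κ → F
  | .inl k, .inr l => if k = l then 1 else 0
  | .inr k, .inl l => if k = l then -1 else 0
  | _, _ => 0

/-- Extend a labelling of the first halves of the hyperbolic pairs to the second halves. -/
def extLabel {κ : Type} {N : ℕ} (l : κ → Fin N) : κ ⊕ κ → Fin N :=
  Sum.elim l (fun k => (l k).rev)

/-- The flag of coordinate subspaces defined by a labelling of a basis. -/
def labelFlag {ι : Type} (b : Basis ι F M) {N : ℕ} (lab : ι → Fin N) :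
    Fin (N + 1) → Submodule F M :=
  fun a => Submodule.span F (b '' {s | (lab s).castSucc < a})

lemma mem_orthB {Q : M →ₗ[F] M →ₗ[F] F} {W : Submodule F M} {u : M} :
    u ∈ orthB Q W ↔ ∀ w ∈ W, Q u w = 0 := Iff.rfl

lemma extLabel_swap {κ : Type} {N : ℕ} (l : κ → Fin N) (s : κ ⊕ κ) :
    extLabel l s.swap = (extLabel l s).rev := by
  cases s <;> simp [extLabel]

lemma exists_castSucc_and_not_succ {N : ℕ} {P : Fin (N + 1) → Prop} (h0 : P 0)
    (hlast : ¬ P (Fin.last N)) : ∃ i : Fin N, P i.castSucc ∧ ¬ P i.succ := by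
  by_contra! h
  exact hlast (Fin.induction (motive := P) h0 h _)

namespace IsDualFlag

variable {Q : M →ₗ[F] M →ₗ[F] F} {N : ℕ} {V : Fin (N + 1) → Submodule F M}

lemma apply_eq_zero (hV : IsDualFlag Q V) {i : Fin N} {a : Fin (N + 1)} {f x : M}
    (hf : f ∈ V i.rev.succ) (ha : a ≤ i.castSucc) (hx : x ∈ V a) : Q x f = 0 := by
  have hx' := hV.mono ha hx
  rw [hV.orth, Fin.rev_castSucc] at hx'
  exact hx' f hf

lemma smul_mem (hV : IsDualFlag Q V) {i : Fin N} {a : Fin (N + 1)} {e f x : M}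
    (he : e ∈ V i.succ) (hf : f ∈ V i.rev.succ) (hx : x ∈ V a) : Q x f • e ∈ V a := by
  rcases le_or_gt a i.castSucc with ha | ha
  · simp [hV.apply_eq_zero hf ha hx]
  · exact (V a).smul_mem _ (hV.mono (Fin.castSucc_lt_iff_succ_le.1 ha) he)

lemma sub_mem (hskew : ∀ u u', Q u u' = - Q u' u) (hV : IsDualFlag Q V) {i : Fin N}
    {a : Fin (N + 1)} {e f x : M}
    (he : e ∈ V i.succ) (hf : f ∈ V i.rev.succ) (hx : x ∈ V a) :
    x - Q x f • e - Q e x • f ∈ V a := by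
  have h : Q x e • f ∈ V a := hV.smul_mem hf (by rwa [Fin.rev_rev]) hx
  rw [hskew e x, neg_smul, sub_neg_eq_add]
  exact add_mem (_root_.sub_mem hx (hV.smul_mem he hf hx)) h

end IsDualFlag

section Step

variable {Q : M →ₗ[F] M →ₗ[F] F} {N N' : ℕ}

lemma exists_hyperbolic_pair [Nontrivial M]
    {V : Fin (N + 1) → Submodule F M} {V' : Fin (N' + 1) → Submodule F M}
    (hV : IsDualFlag Q V) (hV' : IsDualFlag Q V') :
    ∃ (i : Fin N) (j : Fin N') (e f : M), i ≤ i.rev ∧ e ∈ V i.succ ∧ e ∈ V' j.succ ∧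
      f ∈ V i.rev.succ ∧ f ∈ V' j.rev.succ ∧ Q e f = 1 := by
  obtain ⟨i, hi, hi'⟩ := exists_castSucc_and_not_succ (P := fun a => V a = ⊥) hV.bot
    (by rw [hV.top]; exact top_ne_bot)
  obtain ⟨j, hj, hj'⟩ := exists_castSucc_and_not_succ (P := fun b => V i.succ ⊓ V' b = ⊥)
    (by simp [hV'.bot]) (by simpa [hV'.top] using hi')
  have htop : V i.rev.succ = ⊤ := by
    rw [hV.orth, ← Fin.rev_castSucc, Fin.rev_rev, hi, eq_top_iff]
    intro x _ w hw
    rw [(Submodule.mem_bot F).1 hw, map_zero]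
  obtain ⟨e, ⟨he, he'⟩, hne⟩ := Submodule.exists_mem_ne_zero_of_ne_bot hj'
  have hnot : e ∉ V' j.castSucc := fun h =>
    hne ((Submodule.mem_bot F).1 (hj ▸ ⟨he, h⟩))
  rw [hV'.orth, mem_orthB] at hnot
  push Not at hnot
  obtain ⟨w, hw, hne'⟩ := hnot
  rw [Fin.rev_castSucc] at hw
  refine ⟨i, j, e, (Q e w)⁻¹ • w, ?_, he, he', by simp [htop], Submodule.smul_mem _ _ hw, ?_⟩
  · by_contra! hlt
    have h := hV.mono (Fin.castSucc_lt_iff_succ_le.1 (Fin.castSucc_lt_castSucc_iff.2 hlt))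
    rw [htop, hi] at h
    exact top_ne_bot (le_bot_iff.1 h)
  · simp [hne']

/-- The orthogonal complement of a pair of vectors. -/
def pairPerp (Q : M →ₗ[F] M →ₗ[F] F) (e f : M) : Submodule F M :=
  LinearMap.ker (Q e) ⊓ LinearMap.ker (Q f)

lemma sub_mem_pairPerp (hskew : ∀ u u', Q u u' = - Q u' u) (halt : ∀ u, Q u u = 0)
    {e f : M} (hef : Q e f = 1) (x : M) :
    x - Q x f • e - Q e x • f ∈ pairPerp Q e f := by
  have hfe : Q f e = -1 := by rw [hskew, hef]
  constructor
  · simp [halt, hef]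
  · simp [halt, hfe, hskew f x]

lemma IsDualFlag.comap_pairPerp (hskew : ∀ u u', Q u u' = - Q u' u) (halt : ∀ u, Q u u = 0)
    {V : Fin (N + 1) → Submodule F M} (hV : IsDualFlag Q V) {i : Fin N} {e f : M}
    (he : e ∈ V i.succ) (hf : f ∈ V i.rev.succ) (hef : Q e f = 1) :
    IsDualFlag (Q.domRestrict₁₂ (pairPerp Q e f) (pairPerp Q e f))
      (fun a => (V a).comap (pairPerp Q e f).subtype) where
  mono := fun a b hab => Submodule.comap_mono (hV.mono hab)
  bot := by simp [hV.bot]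
  top := by simp [hV.top]
  orth := by
    intro a
    ext x
    rw [Submodule.mem_comap, Submodule.subtype_apply, hV.orth, mem_orthB, mem_orthB]
    constructor
    · intro h w hw
      exact h w hw
    · intro h w hw
      have h1 : Q x (w - Q w f • e - Q e w • f) = 0 :=
        h ⟨_, sub_mem_pairPerp hskew halt hef w⟩ (hV.sub_mem hskew he hf hw)
      have hxe : Q e x = 0 := x.2.1
      have hxf : Q f x = 0 := x.2.2
      simpa [hskew x e, hskew x f, hxe, hxf] using h1

lemma exists_adapted_family [FiniteDimensional F M]
    (hskew : ∀ u u', Q u u' = - Q u' u) (halt : ∀ u, Q u u = 0)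
    {V : Fin (N + 1) → Submodule F M} {V' : Fin (N' + 1) → Submodule F M}
    (hV : IsDualFlag Q V) (hV' : IsDualFlag Q V') :
    ∃ (κ : Type) (_ : Fintype κ) (_ : DecidableEq κ) (b : κ ⊕ κ → M) (l : κ → Fin N)
      (l' : κ → Fin N'), (∀ s t, Q (b s) (b t) = hypForm F s t) ∧
      Submodule.span F (Set.range b) = ⊤ ∧ (∀ s, b s ∈ V (extLabel l s).succ) ∧
      (∀ s, b s ∈ V' (extLabel l' s).succ) ∧ ∀ k, l k ≤ (l k).rev := by
  induction hr : finrank F M using Nat.strong_induction_on generalizing M with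
  | _ r ih =>
    subst hr
    rcases subsingleton_or_nontrivial M with hM | hM
    · exact ⟨Empty, inferInstance, inferInstance, fun _ => 0, Empty.elim, Empty.elim, by simp,
        Subsingleton.elim _ _, by simp, by simp, by simp⟩
    obtain ⟨i, j, e, f, hi, he, he', hf, hf', hef⟩ := exists_hyperbolic_pair hV hV'
    have hfe : Q f e = -1 := by rw [hskew, hef]
    have hlt : finrank F (pairPerp Q e f) < finrank F M := by
      apply Submodule.finrank_lt
      intro h
      have : f ∈ pairPerp Q e f := h ▸ Submodule.mem_top
      have h1 : Q e f = 0 := this.1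
      simp [hef] at h1
    obtain ⟨κ, _, _, b, l, l', hb, hspan, hl, hl', hlr⟩ :=
      ih _ hlt (Q := Q.domRestrict₁₂ (pairPerp Q e f) (pairPerp Q e f))
        (fun u u' => hskew u u') (fun u => halt u)
        (hV.comap_pairPerp hskew halt he hf hef)
        (hV'.comap_pairPerp hskew halt he' hf' hef) rfl
    have hbe : ∀ s, Q e (b s) = 0 := fun s => (b s).2.1
    have hbf : ∀ s, Q f (b s) = 0 := fun s => (b s).2.2
    have heb : ∀ s, Q (b s) e = 0 := fun s => by rw [hskew, hbe, neg_zero]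
    have hfb : ∀ s, Q (b s) f = 0 := fun s => by rw [hskew, hbf, neg_zero]
    have hb' : ∀ s t, Q (b s) (b t) = hypForm F s t := hb
    refine ⟨Option κ, inferInstance, inferInstance,
      Sum.elim (fun o => o.elim e fun k => b (.inl k)) (fun o => o.elim f fun k => b (.inr k)),
      fun o => o.elim i l, fun o => o.elim j l', ?_, ?_, ?_, ?_, ?_⟩
    · rintro ((_ | s) | (_ | s)) ((_ | t) | (_ | t)) <;>
        simp [hypForm, halt, hef, hfe, hbe, hbf, heb, hfb, hb']
    · set c : Option κ ⊕ Option κ → M := Sum.elim (fun o => o.elim e fun k => b (.inl k))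
        (fun o => o.elim f fun k => b (.inr k)) with hc
      have hce : e ∈ Submodule.span F (Set.range c) := Submodule.subset_span ⟨.inl none, rfl⟩
      have hcf : f ∈ Submodule.span F (Set.range c) := Submodule.subset_span ⟨.inr none, rfl⟩
      have hle : pairPerp Q e f ≤ Submodule.span F (Set.range c) := by
        have h1 : (Submodule.span F (Set.range b)).map (pairPerp Q e f).subtype
            = pairPerp Q e f := by rw [hspan, Submodule.map_subtype_top]
        rw [← h1, Submodule.map_span, Submodule.span_le]
        rintro _ ⟨_, ⟨s, rfl⟩, rfl⟩
        rcases s with k | k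
        · exact Submodule.subset_span ⟨.inl (some k), rfl⟩
        · exact Submodule.subset_span ⟨.inr (some k), rfl⟩
      rw [eq_top_iff]
      intro x _
      have hx := add_mem (add_mem (hle (sub_mem_pairPerp hskew halt hef x))
        (Submodule.smul_mem _ (Q e x) hcf)) (Submodule.smul_mem _ (Q x f) hce)
      simpa using hx
    · rintro ((_ | k) | (_ | k))
      exacts [he, hl (.inl k), hf, hl (.inr k)]
    · rintro ((_ | k) | (_ | k))
      exacts [he', hl' (.inl k), hf', hl' (.inr k)]
    · rintro (_ | k)
      · exact hi
      · exact hlr k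

end Step

section LabelFlag

lemma span_image_inf_span_image {ι : Type} (b : Basis ι F M) (S T : Set ι) :
    Submodule.span F (b '' S) ⊓ Submodule.span F (b '' T) = Submodule.span F (b '' (S ∩ T)) := by
  ext x
  simp [Basis.mem_span_image]

lemma finrank_span_image {ι : Type} [Fintype ι] (b : Basis ι F M) (S : Set ι) :
    finrank F (Submodule.span F (b '' S)) = S.ncard := by
  classical
  rw [Set.image_eq_range]
  exact (finrank_span_eq_card (b.linearIndependent.comp _ Subtype.val_injective)).trans
    (by rw [← Nat.card_eq_fintype_card, Nat.card_coe_set_eq])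

variable {ι : Type} (b : Basis ι F M) {N N' : ℕ} (lab : ι → Fin N) (lab' : ι → Fin N')

lemma mem_labelFlag {a : Fin (N + 1)} {x : M} :
    x ∈ labelFlag b lab a ↔ ∀ s, a ≤ (lab s).castSucc → b.repr x s = 0 := by
  rw [labelFlag, Basis.mem_span_image]
  refine forall_congr' fun s => ?_
  simp only [Finset.mem_coe, Finsupp.mem_support_iff, Set.mem_ofPred_eq]
  rw [← not_le, not_imp_not]

lemma finrank_labelFlag [Fintype ι] (a : Fin (N + 1)) :
    finrank F (labelFlag b lab a) = {s | (lab s).castSucc < a}.ncard :=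
  finrank_span_image b _

lemma flagMatrix_labelFlag [Fintype ι] (i : Fin N) (j : Fin N') :
    flagMatrix (labelFlag b lab) (labelFlag b lab') i j = {s | lab s = i ∧ lab' s = j}.ncard := by
  have key : ∀ S T U : Set ι, finrank F ↥(Submodule.span F (b '' S) ⊔
      Submodule.span F (b '' T) ⊓ Submodule.span F (b '' U)) = (S ∪ T ∩ U).ncard := by
    intro S T U
    rw [span_image_inf_span_image, ← Submodule.span_union, ← Set.image_union, finrank_span_image]
  refine (congrArg₂ (· - ·) (key _ _ _) (key _ _ _)).trans ?_
  have hsub : {s | (lab' s).castSucc < j.castSucc} ⊆ {s | (lab' s).castSucc < j.succ} :=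
    fun s hs => lt_trans hs Fin.castSucc_lt_succ
  rw [← Set.ncard_sdiff (Set.union_subset_union_right _ (Set.inter_subset_inter_right _ hsub))
    (Set.toFinite _)]
  congr 1
  ext s
  simp only [Set.mem_ofPred_eq, Set.mem_sdiff, Set.mem_union, Set.mem_inter_iff, Fin.lt_def,
    Fin.ext_iff, Fin.val_castSucc, Fin.val_succ]
  omega

lemma sum_flagMatrix_labelFlag_left [Fintype ι] (j : Fin N') :
    ∑ i, flagMatrix (labelFlag b lab) (labelFlag b lab') i j = {s | lab' s = j}.ncard := by
  classical
  simp only [flagMatrix_labelFlag, Set.ncard_eq_toFinset_card', Set.toFinset_ofPred]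
  rw [Finset.card_eq_sum_card_fiberwise (f := lab) (t := Finset.univ) (by simp)]
  refine Finset.sum_congr rfl fun i _ => ?_
  rw [Finset.filter_filter]
  simp only [and_comm]

lemma sum_flagMatrix_labelFlag [Fintype ι] :
    ∑ i, ∑ j, flagMatrix (labelFlag b lab) (labelFlag b lab') i j = finrank F M := by
  classical
  refine Finset.sum_comm.trans ?_
  rw [finrank_eq_card_basis b]
  simp only [sum_flagMatrix_labelFlag_left, Set.ncard_eq_toFinset_card', Set.toFinset_ofPred]
  rw [← Finset.card_univ,
    Finset.card_eq_sum_card_fiberwise (f := lab') (t := Finset.univ) (by simp)]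

lemma map_labelFlag {M' ι' : Type} [AddCommGroup M'] [Module F M'] (b' : Basis ι' F M')
    (m : ι' → Fin N) (e : ι ≃ ι') (hm : ∀ s, m (e s) = lab s) (a : Fin (N + 1)) :
    (labelFlag b lab a).map (b.equiv b' e : M →ₗ[F] M') = labelFlag b' m a := by
  rw [labelFlag, labelFlag, Submodule.map_span, Set.image_image]
  congr 1
  ext x
  constructor
  · rintro ⟨s, hs, rfl⟩
    exact ⟨e s, by simpa [hm] using hs, by simp⟩
  · rintro ⟨s, hs, rfl⟩
    exact ⟨e.symm s, by simpa [← hm] using hs, by simp⟩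

end LabelFlag

lemma ncard_extLabel {κ : Type} [Fintype κ] {N N' : ℕ} (l : κ → Fin N)
    (l' : κ → Fin N') (i : Fin N) (j : Fin N') :
    {s | extLabel l s = i ∧ extLabel l' s = j}.ncard =
      {k | l k = i ∧ l' k = j}.ncard + {k | l k = i.rev ∧ l' k = j.rev}.ncard := by
  classical
  simp only [Set.ncard_eq_toFinset_card', Set.toFinset_ofPred, Finset.card_filter,
    Fintype.sum_sum_type, extLabel, Sum.elim_inl, Sum.elim_inr, Fin.rev_eq_iff]
  congr!

section Symplectic

variable {κ : Type} [Fintype κ] [DecidableEq κ] {Q : M →ₗ[F] M →ₗ[F] F} {N N' : ℕ}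

lemma sum_mul_hypForm_eq_zero_iff (g : κ ⊕ κ → F) (s : κ ⊕ κ) :
    ∑ t, g t * hypForm F t s.swap = 0 ↔ g s = 0 := by
  rcases s with k | k <;> simp [hypForm, Fintype.sum_sum_type]

lemma linearIndependent_of_hypForm {b : κ ⊕ κ → M}
    (hb : ∀ s t, Q (b s) (b t) = hypForm F s t) : LinearIndependent F b := by
  rw [Fintype.linearIndependent_iff]
  intro g hg s
  rw [← sum_mul_hypForm_eq_zero_iff]
  simpa [hb, LinearMap.sum_apply] using congrArg (fun x => Q x (b s.swap)) hg

lemma repr_eq_zero_iff {b : Basis (κ ⊕ κ) F M}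
    (hb : ∀ s t, Q (b s) (b t) = hypForm F s t) (x : M) (s : κ ⊕ κ) :
    b.repr x s = 0 ↔ Q x (b s.swap) = 0 := by
  have h : Q x (b s.swap) = ∑ t, b.repr x t * hypForm F t s.swap := by
    nth_rw 1 [← b.sum_repr x]
    simp only [map_sum, LinearMap.sum_apply, map_smul, LinearMap.smul_apply, smul_eq_mul, hb]
  rw [h, sum_mul_hypForm_eq_zero_iff]

lemma isDualFlag_labelFlag {b : Basis (κ ⊕ κ) F M}
    (hb : ∀ s t, Q (b s) (b t) = hypForm F s t) (l : κ → Fin N) :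
    IsDualFlag Q (labelFlag b (extLabel l)) where
  mono := fun a a' h => Submodule.span_mono (Set.image_mono fun s hs => lt_of_lt_of_le hs h)
  bot := by simp [labelFlag]
  top := by simp [labelFlag, Fin.castSucc_lt_last, b.span_eq]
  orth := by
    intro a
    ext x
    rw [mem_labelFlag, mem_orthB]
    have key : ∀ s, (extLabel l s.swap).castSucc < a.rev ↔ a ≤ (extLabel l s).castSucc := by
      intro s
      rw [extLabel_swap]
      simp only [Fin.lt_def, Fin.le_def, Fin.val_castSucc, Fin.val_rev]
      omega
    constructor
    · intro h w hw
      have hle : labelFlag b (extLabel l) a.rev ≤ LinearMap.ker (Q x) := by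
        rw [labelFlag, Submodule.span_le]
        rintro _ ⟨s, hs, rfl⟩
        have := (repr_eq_zero_iff hb x s.swap).1 (h _ ((key _).1 (by simpa using hs)))
        simpa using this
      exact hle hw
    · intro h s hs
      rw [repr_eq_zero_iff hb]
      exact h _ (Submodule.subset_span ⟨_, (key s).2 hs, rfl⟩)

lemma eq_labelFlag {b : Basis (κ ⊕ κ) F M}
    (hb : ∀ s t, Q (b s) (b t) = hypForm F s t) {V : Fin (N + 1) → Submodule F M}
    (hV : IsDualFlag Q V) (l : κ → Fin N) (h : ∀ s, b s ∈ V (extLabel l s).succ) :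
    V = labelFlag b (extLabel l) := by
  funext a
  apply le_antisymm
  · intro x hx
    rw [mem_labelFlag]
    intro s hs
    rw [repr_eq_zero_iff hb]
    exact hV.apply_eq_zero (by rw [← extLabel_swap]; exact h _) hs hx
  · rw [labelFlag, Submodule.span_le]
    rintro _ ⟨s, hs, rfl⟩
    exact hV.mono (Fin.castSucc_lt_iff_succ_le.1 hs) (h s)

end Symplectic

section Classification

variable {Q : M →ₗ[F] M →ₗ[F] F} {N N' : ℕ}

theorem exists_adapted_basis [FiniteDimensional F M]
    (hskew : ∀ u u', Q u u' = - Q u' u) (halt : ∀ u, Q u u = 0)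
    {V : Fin (N + 1) → Submodule F M} {V' : Fin (N' + 1) → Submodule F M}
    (hV : IsDualFlag Q V) (hV' : IsDualFlag Q V') :
    ∃ (κ : Type) (_ : Fintype κ) (_ : DecidableEq κ) (b : Basis (κ ⊕ κ) F M) (l : κ → Fin N)
      (l' : κ → Fin N'), (∀ s t, Q (b s) (b t) = hypForm F s t) ∧
      V = labelFlag b (extLabel l) ∧ V' = labelFlag b (extLabel l') ∧ ∀ k, l k ≤ (l k).rev := by
  obtain ⟨κ, _, _, c, l, l', hc, hspan, hl, hl', hlr⟩ := exists_adapted_family hskew halt hV hV'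
  set b := Basis.mk (linearIndependent_of_hypForm hc) hspan.ge with hb
  have hbc : ∀ s, b s = c s := fun s => by simp [hb]
  have hb' : ∀ s t, Q (b s) (b t) = hypForm F s t := fun s t => by simp only [hbc, hc]
  exact ⟨κ, ‹_›, ‹_›, b, l, l', hb', eq_labelFlag hb' hV l fun s => hbc s ▸ hl s,
    eq_labelFlag hb' hV' l' fun s => hbc s ▸ hl' s, hlr⟩

theorem exists_symplectic_basis [FiniteDimensional F M]
    (hskew : ∀ u u', Q u u' = - Q u' u) (halt : ∀ u, Q u u = 0)
    (hnd : ∀ u, (∀ u', Q u u' = 0) → u = 0) :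
    ∃ (κ : Type) (_ : Fintype κ) (_ : DecidableEq κ) (b : Basis (κ ⊕ κ) F M),
      ∀ s t, Q (b s) (b t) = hypForm F s t := by
  have hV : IsDualFlag Q (![⊥, ⊤] : Fin (1 + 1) → Submodule F M) :=
    { mono := by
        intro a b hab
        fin_cases a <;> fin_cases b <;> first | exact le_rfl | exact bot_le | simp at hab
      bot := rfl
      top := rfl
      orth := by
        intro i
        ext x
        rw [mem_orthB]
        fin_cases i
        · simpa using ⟨fun h => by simp [h], hnd x⟩
        · simp }
  obtain ⟨κ, _, _, b, _, _, hb, -⟩ := exists_adapted_basis hskew halt hV hV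
  exact ⟨κ, ‹_›, ‹_›, b, hb⟩

lemma flagMatrix_rev [FiniteDimensional F M]
    (hskew : ∀ u u', Q u u' = - Q u' u) (halt : ∀ u, Q u u = 0)
    {V : Fin (N + 1) → Submodule F M} {V' : Fin (N' + 1) → Submodule F M}
    (hV : IsDualFlag Q V) (hV' : IsDualFlag Q V') (i : Fin N) (j : Fin N') :
    flagMatrix V V' i j = flagMatrix V V' i.rev j.rev := by
  obtain ⟨κ, _, _, b, l, l', hb, rfl, rfl, -⟩ := exists_adapted_basis hskew halt hV hV'
  simp only [flagMatrix_labelFlag, ncard_extLabel, Fin.rev_rev]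
  rw [add_comm]

lemma sum_flagMatrix [FiniteDimensional F M]
    (hskew : ∀ u u', Q u u' = - Q u' u) (halt : ∀ u, Q u u = 0)
    {V : Fin (N + 1) → Submodule F M} {V' : Fin (N' + 1) → Submodule F M}
    (hV : IsDualFlag Q V) (hV' : IsDualFlag Q V') :
    ∑ i, ∑ j, flagMatrix V V' i j = finrank F M := by
  obtain ⟨κ, _, _, b, l, l', hb, rfl, rfl, -⟩ := exists_adapted_basis hskew halt hV hV'
  exact sum_flagMatrix_labelFlag _ _ _

/-- The column sums of the matrix of a pair of flags are the jumps of the second flag. -/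
lemma finrank_succ_eq [FiniteDimensional F M]
    (hskew : ∀ u u', Q u u' = - Q u' u) (halt : ∀ u, Q u u = 0)
    {V : Fin (N + 1) → Submodule F M} {V' : Fin (N' + 1) → Submodule F M}
    (hV : IsDualFlag Q V) (hV' : IsDualFlag Q V') (j : Fin N') :
    finrank F (V' j.succ) = finrank F (V' j.castSucc) + ∑ i, flagMatrix V V' i j := by
  obtain ⟨κ, _, _, b, l, l', hb, rfl, rfl, -⟩ := exists_adapted_basis hskew halt hV hV'
  rw [sum_flagMatrix_labelFlag_left, finrank_labelFlag, finrank_labelFlag,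
    ← Set.ncard_union_eq _ (Set.toFinite _) (Set.toFinite _)]
  · congr 1
    ext s
    simp only [Set.mem_ofPred_eq, Set.mem_union, Fin.lt_def, Fin.ext_iff, Fin.val_castSucc,
      Fin.val_succ]
    omega
  · rw [Set.disjoint_left]
    intro s
    simp only [Set.mem_ofPred_eq, Fin.lt_def, Fin.ext_iff, Fin.val_castSucc]
    omega

lemma finrank_eq_val {V' : Fin (N' + 1) → Submodule F M} (h0 : V' 0 = ⊥)
    (h : ∀ j : Fin N', finrank F (V' j.succ) = finrank F (V' j.castSucc) + 1)
    (a : Fin (N' + 1)) : finrank F (V' a) = a := by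
  induction a using Fin.induction with
  | zero => rw [h0, finrank_bot]; rfl
  | succ j ih => rw [h, ih]; simp

theorem exists_flags_of_matrix [FiniteDimensional F M]
    (hskew : ∀ u u', Q u u' = - Q u' u) (halt : ∀ u, Q u u = 0)
    (hnd : ∀ u, (∀ u', Q u u' = 0) → u = 0) (hN : Even N)
    (A : Matrix (Fin N) (Fin N') ℕ) (hsum : ∑ i, ∑ j, A i j = finrank F M)
    (hA : ∀ i j, A i j = A i.rev j.rev) :
    ∃ (V : Fin (N + 1) → Submodule F M) (V' : Fin (N' + 1) → Submodule F M),
      IsDualFlag Q V ∧ IsDualFlag Q V' ∧ flagMatrix V V' = A := by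
  classical
  obtain ⟨κ₀, _, _, b₀, hb₀⟩ := exists_symplectic_basis hskew halt hnd
  let κ := (p : {p : Fin N × Fin N' // p.1 < p.1.rev}) × Fin (A p.1.1 p.1.2)
  let l : κ → Fin N := fun k => k.1.1.1
  let l' : κ → Fin N' := fun k => k.1.1.2
  have hlt : ∀ i j, i < i.rev → {k | l k = i ∧ l' k = j}.ncard = A i j := by
    intro i j hij
    have : {k | l k = i ∧ l' k = j} =
        Set.range (Sigma.mk (β := fun p : {p : Fin N × Fin N' // p.1 < p.1.rev} =>
          Fin (A p.1.1 p.1.2)) ⟨(i, j), hij⟩) := by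
      ext ⟨⟨⟨i', j'⟩, h⟩, x⟩
      constructor
      · rintro ⟨h1, h2⟩
        change i' = i at h1
        change j' = j at h2
        subst h1 h2
        exact ⟨x, rfl⟩
      · rintro ⟨y, hy⟩
        rw [← hy]
        exact ⟨rfl, rfl⟩
    rw [this, ← Set.image_univ, Set.ncard_image_of_injective _ sigma_mk_injective]
    simp
  have hge : ∀ i j, ¬ i < i.rev → {k | l k = i ∧ l' k = j}.ncard = 0 := by
    intro i j hij
    rw [Set.ncard_eq_zero, Set.eq_empty_iff_forall_notMem]
    rintro ⟨⟨⟨i', j'⟩, h⟩, x⟩ ⟨h1, -⟩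
    change i' = i at h1
    exact hij (h1 ▸ h)
  have hcount : ∀ i j, {s | extLabel l s = i ∧ extLabel l' s = j}.ncard = A i j := by
    intro i j
    rw [ncard_extLabel]
    by_cases hi : i < i.rev
    · rw [hlt _ _ hi, hge _ _ (by rw [Fin.rev_rev]; exact hi.not_gt), add_zero]
    · have hi' : i.rev < i.rev.rev := by
        obtain ⟨n, rfl⟩ := hN
        simp only [Fin.lt_def, Fin.val_rev] at hi ⊢
        omega
      rw [hge _ _ hi, hlt _ _ hi', zero_add, ← hA]
  have hcard : Fintype.card κ = Fintype.card κ₀ := by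
    have h1 := finrank_eq_card_basis b₀
    have h2 := sum_flagMatrix_labelFlag (Finsupp.basisSingleOne (R := F) (ι := κ ⊕ κ))
      (extLabel l) (extLabel l')
    simp only [flagMatrix_labelFlag, hcount] at h2
    rw [finrank_eq_card_basis (Finsupp.basisSingleOne (R := F) (ι := κ ⊕ κ))] at h2
    simp only [Fintype.card_sum] at h1 h2
    omega
  let π := Fintype.equivOfCardEq hcard
  let b := b₀.reindex (Equiv.sumCongr π π).symm
  have hb : ∀ s t, Q (b s) (b t) = hypForm F s t := by
    rintro (s | s) (t | t) <;> simp [b, hb₀, hypForm]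
  refine ⟨labelFlag b (extLabel l), labelFlag b (extLabel l'), isDualFlag_labelFlag hb l,
    isDualFlag_labelFlag hb l', ?_⟩
  ext i j
  rw [flagMatrix_labelFlag, hcount]

lemma exists_equiv_of_ncard_fiber_eq {α β γ : Type} [Finite α] [Finite β] (f : α → γ) (g : β → γ)
    (h : ∀ c, {a | f a = c}.ncard = {a | g a = c}.ncard) : ∃ e : α ≃ β, ∀ a, g (e a) = f a := by
  let e : ∀ c, {a // f a = c} ≃ {b // g b = c} := fun c => (Finite.card_eq.1 (h c)).some
  refine ⟨(Equiv.sigmaFiberEquiv f).symm.trans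
    ((Equiv.sigmaCongrRight e).trans (Equiv.sigmaFiberEquiv g)), fun a => ?_⟩
  exact (e (f a) ⟨a, rfl⟩).2

lemma ncard_eq_of_extLabel {κ : Type} [Fintype κ] (hN : Even N) {l : κ → Fin N}
    (l' : κ → Fin N') (hl : ∀ k, l k ≤ (l k).rev) (i : Fin N) (j : Fin N') :
    {k | l k = i ∧ l' k = j}.ncard =
      if i < i.rev then {s | extLabel l s = i ∧ extLabel l' s = j}.ncard else 0 := by
  classical
  have hge : ∀ i j, ¬ i < i.rev → {k | l k = i ∧ l' k = j}.ncard = 0 := by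
    intro i j hij
    rw [Set.ncard_eq_zero, Set.eq_empty_iff_forall_notMem]
    rintro k ⟨rfl, -⟩
    have := hl k
    obtain ⟨n, rfl⟩ := hN
    simp only [Fin.lt_def, Fin.le_def, Fin.val_rev] at *
    omega
  split_ifs with h
  · rw [ncard_extLabel, hge i.rev _ (by rw [Fin.rev_rev]; exact h.not_gt), add_zero]
  · exact hge _ _ h

lemma flagMatrix_map [FiniteDimensional F M] (g : M ≃ₗ[F] M) (V : Fin (N + 1) → Submodule F M)
    (V' : Fin (N' + 1) → Submodule F M) :
    flagMatrix (fun a => (V a).map (g : M →ₗ[F] M)) (fun a => (V' a).map (g : M →ₗ[F] M))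
      = flagMatrix V V' := by
  have key : ∀ A B C : Submodule F M,
      finrank F ↥(A.map (g : M →ₗ[F] M) ⊔ B.map (g : M →ₗ[F] M) ⊓ C.map (g : M →ₗ[F] M))
        = finrank F ↥(A ⊔ B ⊓ C) := by
    intro A B C
    rw [← Submodule.map_inf _ g.injective, ← Submodule.map_sup]
    exact LinearEquiv.finrank_map_eq g _
  ext i j
  exact congrArg₂ (· - ·) (key _ _ _) (key _ _ _)

theorem flagMatrix_eq_iff [FiniteDimensional F M]
    (hskew : ∀ u u', Q u u' = - Q u' u) (halt : ∀ u, Q u u = 0) (hN : Even N)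
    {V W : Fin (N + 1) → Submodule F M} {V' W' : Fin (N' + 1) → Submodule F M}
    (hV : IsDualFlag Q V) (hV' : IsDualFlag Q V') (hW : IsDualFlag Q W) (hW' : IsDualFlag Q W') :
    flagMatrix V V' = flagMatrix W W' ↔
      ∃ g : M ≃ₗ[F] M, inIsom Q g ∧ (∀ i, (V i).map (g : M →ₗ[F] M) = W i) ∧
        ∀ i, (V' i).map (g : M →ₗ[F] M) = W' i := by
  constructor
  · intro h
    obtain ⟨κ, _, _, b, l, l', hb, rfl, rfl, hl⟩ := exists_adapted_basis hskew halt hV hV'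
    obtain ⟨κ₂, _, _, c, m, m', hc, rfl, rfl, hm⟩ := exists_adapted_basis hskew halt hW hW'
    obtain ⟨e, he⟩ := exists_equiv_of_ncard_fiber_eq (fun k => (l k, l' k))
      (fun k => (m k, m' k)) (by
        rintro ⟨i, j⟩
        have hij := congrFun (congrFun h i) j
        rw [flagMatrix_labelFlag, flagMatrix_labelFlag] at hij
        simp only [Prod.mk.injEq]
        rw [ncard_eq_of_extLabel hN l' hl, ncard_eq_of_extLabel hN m' hm, hij])
    simp only [Prod.mk.injEq] at he
    refine ⟨b.equiv c (Equiv.sumCongr e e), ?_, map_labelFlag _ _ _ _ _ ?_,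
      map_labelFlag _ _ _ _ _ ?_⟩
    · have hQ : Q.compl₁₂ (b.equiv c (Equiv.sumCongr e e) : M →ₗ[F] M)
          (b.equiv c (Equiv.sumCongr e e) : M →ₗ[F] M) = Q := by
        refine LinearMap.ext_basis b b fun s t => ?_
        rcases s with s | s <;> rcases t with t | t <;> simp [hb, hc, hypForm]
      intro u u'
      exact LinearMap.congr_fun₂ hQ u u'
    · rintro (k | k) <;> simp [extLabel, he]
    · rintro (k | k) <;> simp [extLabel, he]
  · rintro ⟨g, -, h, h'⟩
    obtain rfl : (fun a => (V a).map (g : M →ₗ[F] M)) = W := funext h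
    obtain rfl : (fun a => (V' a).map (g : M →ₗ[F] M)) = W' := funext h'
    exact (flagMatrix_map g V V').symm

end Classification

end AdaptedBases

lemma IsXCFlag.isDualFlag {n d : ℕ} {F : Type} [Field F]
    {Q : (Fin (2*d) → F) →ₗ[F] (Fin (2*d) → F) →ₗ[F] F}
    {V : Fin (2*n+1) → Submodule F (Fin (2*d) → F)} (h : IsXCFlag n d F Q V) :
    IsDualFlag Q V :=
  ⟨h.1, h.2.1, h.2.2.1, h.2.2.2⟩

lemma IsDualFlag.isXCFlag {n d : ℕ} {F : Type} [Field F]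
    {Q : (Fin (2*d) → F) →ₗ[F] (Fin (2*d) → F) →ₗ[F] F}
    {V : Fin (2*n+1) → Submodule F (Fin (2*d) → F)} (h : IsDualFlag Q V) :
    IsXCFlag n d F Q V :=
  ⟨h.mono, h.bot, h.top, h.orth⟩

lemma IsYCFlag.isDualFlag {d : ℕ} {F : Type} [Field F]
    {Q : (Fin (2*d) → F) →ₗ[F] (Fin (2*d) → F) →ₗ[F] F}
    {V : Fin (2*d+1) → Submodule F (Fin (2*d) → F)} (h : IsYCFlag d F Q V) :
    IsDualFlag Q V :=
  ⟨h.1, h.2.1, h.2.2.1, h.2.2.2.2⟩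

/-- The assignment `(V,V') ↦ A` is constant on `Sp(D)`-orbits of `X_C × X_C` and induces
a bijection from the set of `Sp(D)`-orbits onto `Ξ_C`; likewise `(V,F) ↦ B` induces a
bijection from the set of `Sp(D)`-orbits on `X_C × Y_C` onto `Π_C`. -/
theorem stmt16 (n d : ℕ) (hn : 0 < n) (hd : 0 < d)
    (F : Type) [Field F] [Fintype F] (hodd : Odd (Fintype.card F))
    (Q : (Fin (2*d) → F) →ₗ[F] (Fin (2*d) → F) →ₗ[F] F)
    (hQskew : ∀ u u', Q u u' = - Q u' u) (hQalt : ∀ u, Q u u = 0)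
    (hQnd : ∀ u, (∀ u', Q u u' = 0) → u = 0) :
    -- (a) the matrix of a pair of flags in `X_C × X_C` lies in `Ξ_C`
    (∀ V V', IsXCFlag n d F Q V → IsXCFlag n d F Q V' →
      (∑ i, ∑ j, matXX n d F V V' i j) = 2*d
        ∧ ∀ i j, matXX n d F V V' i j = matXX n d F V V' i.rev j.rev)
    -- (b) every matrix in `Ξ_C` arises this way
    ∧ (∀ A : Matrix (Fin (2*n)) (Fin (2*n)) ℕ,
        ((∑ i, ∑ j, A i j) = 2*d ∧ ∀ i j, A i j = A i.rev j.rev) →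
        ∃ V V', IsXCFlag n d F Q V ∧ IsXCFlag n d F Q V' ∧ matXX n d F V V' = A)
    -- (c) two pairs have the same matrix iff they lie in the same `Sp(D)`-orbit
    ∧ (∀ V V' W W', IsXCFlag n d F Q V → IsXCFlag n d F Q V' →
        IsXCFlag n d F Q W → IsXCFlag n d F Q W' →
        (matXX n d F V V' = matXX n d F W W' ↔
          ∃ g : (Fin (2*d) → F) ≃ₗ[F] (Fin (2*d) → F), inIsom Q g
            ∧ (∀ i, (V i).map (g : (Fin (2*d) → F) →ₗ[F] (Fin (2*d) → F)) = W i)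
            ∧ (∀ i, (V' i).map (g : (Fin (2*d) → F) →ₗ[F] (Fin (2*d) → F)) = W' i)))
    -- (a') the matrix of a pair in `X_C × Y_C` lies in `Π_C`
    ∧ (∀ V Fl, IsXCFlag n d F Q V → IsYCFlag d F Q Fl →
      (∀ j, ∑ i, matXY n d F V Fl i j = 1)
        ∧ ∀ i j, matXY n d F V Fl i j = matXY n d F V Fl i.rev j.rev)
    -- (b') every matrix in `Π_C` arises this way
    ∧ (∀ B : Matrix (Fin (2*n)) (Fin (2*d)) ℕ,
        ((∀ j, ∑ i, B i j = 1) ∧ ∀ i j, B i j = B i.rev j.rev) →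
        ∃ V Fl, IsXCFlag n d F Q V ∧ IsYCFlag d F Q Fl ∧ matXY n d F V Fl = B)
    -- (c') fibers of the assignment on `X_C × Y_C` are exactly the `Sp(D)`-orbits
    ∧ (∀ V Fl W Gl, IsXCFlag n d F Q V → IsYCFlag d F Q Fl →
        IsXCFlag n d F Q W → IsYCFlag d F Q Gl →
        (matXY n d F V Fl = matXY n d F W Gl ↔
          ∃ g : (Fin (2*d) → F) ≃ₗ[F] (Fin (2*d) → F), inIsom Q g
            ∧ (∀ i, (V i).map (g : (Fin (2*d) → F) →ₗ[F] (Fin (2*d) → F)) = W i)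
            ∧ (∀ i, (Fl i).map (g : (Fin (2*d) → F) →ₗ[F] (Fin (2*d) → F)) = Gl i))) := by
  refine ⟨?_, ?_, ?_, ?_, ?_, ?_⟩
  · intro V V' hV hV'
    exact ⟨(sum_flagMatrix hQskew hQalt hV.isDualFlag hV'.isDualFlag).trans (by simp),
      flagMatrix_rev hQskew hQalt hV.isDualFlag hV'.isDualFlag⟩
  · rintro A ⟨hsum, hA⟩
    obtain ⟨V, V', hV, hV', h⟩ :=
      exists_flags_of_matrix hQskew hQalt hQnd (even_two_mul n) A (by simpa using hsum) hA
    exact ⟨V, V', hV.isXCFlag, hV'.isXCFlag, h⟩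
  · intro V V' W W' hV hV' hW hW'
    exact flagMatrix_eq_iff hQskew hQalt (even_two_mul n) hV.isDualFlag hV'.isDualFlag
      hW.isDualFlag hW'.isDualFlag
  · intro V Fl hV hFl
    refine ⟨fun j => ?_, flagMatrix_rev hQskew hQalt hV.isDualFlag hFl.isDualFlag⟩
    have h := finrank_succ_eq hQskew hQalt hV.isDualFlag hFl.isDualFlag j
    rw [hFl.2.2.2.1, hFl.2.2.2.1, Fin.val_succ, Fin.val_castSucc] at h
    exact (Nat.add_left_cancel h).symm
  · rintro B ⟨hsum, hB⟩
    obtain ⟨V, Fl, hV, hFl, h⟩ :=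
      exists_flags_of_matrix hQskew hQalt hQnd (even_two_mul n) B
        (Finset.sum_comm.trans (by simp [hsum])) hB
    refine ⟨V, Fl, hV.isXCFlag, ⟨hFl.mono, hFl.bot, hFl.top, ?_, hFl.orth⟩, h⟩
    refine finrank_eq_val hFl.bot fun j => ?_
    rw [finrank_succ_eq hQskew hQalt hV hFl, h, hsum]
  · intro V Fl W Gl hV hFl hW hGl
    exact flagMatrix_eq_iff hQskew hQalt (even_two_mul n) hV.isDualFlag hFl.isDualFlag
      hW.isDualFlag hGl.isDualFlag
end
end
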